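/- If Y ⊆ ℝ² is a Borel set with dim_H Y > 1, then for every σ ∈ [0,1], the set {x ∈ ℝ² : dim_H π_x(Y \ {x}) < σ} has Hausdorff dimension at most max{1 + σ − dim_H Y, 0}. -/

import Mathlib

open Metric MeasureTheory Set
open scoped ENNReal NNReal RealInnerProductSpace

noncomputable section

abbrev E2 := EuclideanSpace ℝ (Fin 2)

/-- Radial projection `π_x(y) = (y-x)/|y-x|`. -/
def radProj {E : Type*} [NormedAddCommGroup E] [NormedSpace ℝ E] (x y : E) : E :=
  ‖y - x‖⁻¹ • (y - x)

/-- A subset of a real vector space is an affine line. -/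
def IsAffineLine {E : Type*} [AddCommGroup E] [Module ℝ E] (ℓ : Set E) : Prop :=
  ∃ a v : E, v ≠ 0 ∧ ℓ = {p | ∃ t : ℝ, p = a + t • v}

/-- The (topological) support of a measure. -/
def msupport {E : Type*} [PseudoMetricSpace E] [MeasurableSpace E] (μ : Measure E) : Set E :=
  {x | ∀ r : ℝ, 0 < r → 0 < μ (ball x r)}

/-- `(μ,ν)` has `(t,K,c)`-thin tubes. -/
def ThinTubesWith (μ ν : Measure E2) (t K c : ℝ) : Prop :=
  ∃ G : Set (E2 × E2), MeasurableSet G ∧ G ⊆ (msupport μ) ×ˢ (msupport ν) ∧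
    ENNReal.ofReal c ≤ (μ.prod ν) G ∧
    ∀ x ∈ msupport μ, ∀ r : ℝ, 0 < r → ∀ ℓ : Set E2, IsAffineLine ℓ →
      x ∈ cthickening r ℓ →
      ν (cthickening r ℓ ∩ {y | (x, y) ∈ G}) ≤ ENNReal.ofReal (K * r ^ t)

/-- `(μ,ν)` has `t`-thin tubes. -/
def ThinTubes (μ ν : Measure E2) (t : ℝ) : Prop :=
  ∃ K c : ℝ, 0 < K ∧ 0 < c ∧ ThinTubesWith μ ν t K c

section Capacity

variable {ι α : Type*}

/-- The set `E` admits a nonnegative square-summable test function of norm at most `R` whose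
potential with respect to the features `g` is at least `1` on `E`. The infimum of such `R` is the
square root of an `ℓ²`-capacity of `E`. -/
def CapLE (g : ι → α → ℝ) (E : Set α) (R : ℝ) : Prop :=
  ∃ f : lp (fun _ : ι => ℝ) 2, (∀ i, 0 ≤ f i) ∧ ‖f‖ ≤ R ∧
    ∀ x ∈ E, ∀ c < 1, ∃ S : Finset ι, c < ∑ i ∈ S, f i * g i x

lemma CapLE.mono {g : ι → α → ℝ} {E F : Set α} {R R' : ℝ} (h : CapLE g F R) (hE : E ⊆ F)
    (hR : R ≤ R') : CapLE g E R' := by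
  obtain ⟨f, h0, h1, h2⟩ := h
  exact ⟨f, h0, h1.trans hR, fun x hx => h2 x (hE hx)⟩

lemma CapLE.nonneg {g : ι → α → ℝ} {E : Set α} {R : ℝ} (h : CapLE g E R) : 0 ≤ R := by
  obtain ⟨f, -, h1, -⟩ := h
  exact (norm_nonneg f).trans h1

lemma CapLE.empty (g : ι → α → ℝ) {R : ℝ} (hR : 0 ≤ R) : CapLE g ∅ R :=
  ⟨0, fun i => by simp, by simpa using hR, by simp⟩

lemma CapLE.union {g : ι → α → ℝ} (hg : ∀ i x, 0 ≤ g i x) {E F : Set α} {R R' : ℝ}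
    (hE : CapLE g E R) (hF : CapLE g F R') : CapLE g (E ∪ F) (R + R') := by
  obtain ⟨f, f0, f1, f2⟩ := hE
  obtain ⟨k, k0, k1, k2⟩ := hF
  refine ⟨f + k, fun i => ?_, (norm_add_le f k).trans (add_le_add f1 k1), ?_⟩
  · simpa using add_nonneg (f0 i) (k0 i)
  · rintro x (hx | hx) c hc
    · obtain ⟨S, hS⟩ := f2 x hx c hc
      refine ⟨S, hS.trans_le (Finset.sum_le_sum fun i _ => ?_)⟩
      exact mul_le_mul_of_nonneg_right (by simpa using k0 i) (hg i x)
    · obtain ⟨S, hS⟩ := k2 x hx c hc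
      refine ⟨S, hS.trans_le (Finset.sum_le_sum fun i _ => ?_)⟩
      exact mul_le_mul_of_nonneg_right (by simpa using f0 i) (hg i x)

lemma CapLE.biUnion {κ : Type*} {g : ι → α → ℝ} (hg : ∀ i x, 0 ≤ g i x) (s : Finset κ)
    (E : κ → Set α) (R : κ → ℝ) (h : ∀ k ∈ s, CapLE g (E k) (R k)) :
    CapLE g (⋃ k ∈ s, E k) (∑ k ∈ s, R k) := by
  classical
  induction s using Finset.induction_on with
  | empty => simpa using CapLE.empty g le_rfl
  | insert a s ha ih =>
    rw [Finset.sum_insert ha, Finset.set_biUnion_insert]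
    exact (h a (Finset.mem_insert_self a s)).union hg
      (ih fun k hk => h k (Finset.mem_insert_of_mem hk))

lemma CapLE.exists_isOpen [TopologicalSpace α] {g : ι → α → ℝ} (hg : ∀ i, Continuous (g i))
    {E : Set α} {R R' : ℝ} (h : CapLE g E R) (hR : R < R') :
    ∃ U, IsOpen U ∧ E ⊆ U ∧ CapLE g U R' := by
  have hR0 := h.nonneg
  obtain ⟨f, f0, f1, f2⟩ := h
  obtain ⟨a, ha1, haR⟩ : ∃ a : ℝ, 1 < a ∧ a * R ≤ R' := by
    rcases hR0.eq_or_lt with h0 | h0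
    · exact ⟨2, by norm_num, by rw [← h0] at hR ⊢; linarith⟩
    · exact ⟨R' / R, by rwa [one_lt_div h0], by rw [div_mul_cancel₀ _ h0.ne']⟩
  have hsum : ∀ (S : Finset ι) x,
      ∑ i ∈ S, (a • f) i * g i x = a * ∑ i ∈ S, f i * g i x := by
    intro S x
    rw [Finset.mul_sum]
    exact Finset.sum_congr rfl fun i _ => by simp [mul_assoc]
  refine ⟨⋃ S : Finset ι, {x | 1 < ∑ i ∈ S, (a • f) i * g i x}, ?_, ?_, a • f, ?_, ?_, ?_⟩
  · refine isOpen_iUnion fun S => isOpen_lt continuous_const ?_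
    exact continuous_finsetSum _ fun i _ => continuous_const.mul (hg i)
  · intro x hx
    obtain ⟨S, hS⟩ := f2 x hx (1 / a) (by rw [div_lt_one (by linarith)]; exact ha1)
    refine mem_iUnion.2 ⟨S, ?_⟩
    rw [mem_ofPred_eq]
    rw [hsum]
    rw [div_lt_iff₀ (by linarith)] at hS
    linarith
  · intro i
    have := f0 i
    simp only [lp.coeFn_smul, Pi.smul_apply, smul_eq_mul]
    positivity
  · rw [norm_smul, Real.norm_of_nonneg (by linarith)]
    exact (mul_le_mul_of_nonneg_left f1 (by linarith)).trans haR
  · intro x hx c hc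
    obtain ⟨S, hS⟩ := mem_iUnion.1 hx
    exact ⟨S, hc.trans hS⟩

/-- Pointwise absolute value of an `ℓ²` sequence. -/
def lpAbs (f : lp (fun _ : ι => ℝ) 2) : lp (fun _ : ι => ℝ) 2 :=
  ⟨fun i => ‖f i‖, memℓp_norm_iff.2 (lp.memℓp f)⟩

lemma lpAbs_apply (f : lp (fun _ : ι => ℝ) 2) (i : ι) : lpAbs f i = |f i| := rfl

lemma norm_lpAbs (f : lp (fun _ : ι => ℝ) 2) : ‖lpAbs f‖ = ‖f‖ := by
  refine le_antisymm (lp.norm_mono (by norm_num) fun i => ?_)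
    (lp.norm_mono (by norm_num) fun i => ?_) <;> simp [lpAbs_apply]

lemma CapLE.iUnion {g : ι → α → ℝ} (hg : ∀ i x, 0 ≤ g i x) {E : ℕ → Set α} (hE : Monotone E)
    {R R' : ℝ} (h : ∀ n, CapLE g (E n) R) (hR : R < R') : CapLE g (⋃ n, E n) R' := by
  have hR0 := (h 0).nonneg
  set 𝒦 : ℕ → Set (lp (fun _ : ι => ℝ) 2) := fun n => {f | (∀ i, 0 ≤ f i) ∧
    ∀ x ∈ E n, ∀ c < 1, ∃ S : Finset ι, c < ∑ i ∈ S, f i * g i x} with h𝒦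
  have hanti : ∀ m n, m ≤ n → 𝒦 n ⊆ 𝒦 m := fun m n hmn f hf =>
    ⟨hf.1, fun x hx => hf.2 x (hE hmn hx)⟩
  have hmid : ∀ n, ∀ f ∈ 𝒦 n, ∀ k ∈ 𝒦 n, (1 / 2 : ℝ) • (f + k) ∈ 𝒦 n := by
    classical
    intro n f hf k hk
    refine ⟨fun i => ?_, fun x hx c hc => ?_⟩
    · have := hf.1 i
      have := hk.1 i
      simp only [lp.coeFn_smul, lp.coeFn_add, Pi.smul_apply, Pi.add_apply, smul_eq_mul]
      positivity
    · obtain ⟨S, hS⟩ := hf.2 x hx c hc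
      obtain ⟨T, hT⟩ := hk.2 x hx c hc
      refine ⟨S ∪ T, ?_⟩
      have h1 : ∑ i ∈ S, f i * g i x ≤ ∑ i ∈ S ∪ T, f i * g i x :=
        Finset.sum_le_sum_of_subset_of_nonneg Finset.subset_union_left
          fun i _ _ => mul_nonneg (hf.1 i) (hg i x)
      have h2 : ∑ i ∈ T, k i * g i x ≤ ∑ i ∈ S ∪ T, k i * g i x :=
        Finset.sum_le_sum_of_subset_of_nonneg Finset.subset_union_right
          fun i _ _ => mul_nonneg (hk.1 i) (hg i x)
      have h3 : ∑ i ∈ S ∪ T, ((1 / 2 : ℝ) • (f + k)) i * g i x =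
          1 / 2 * (∑ i ∈ S ∪ T, f i * g i x + ∑ i ∈ S ∪ T, k i * g i x) := by
        rw [← Finset.sum_add_distrib, Finset.mul_sum]
        refine Finset.sum_congr rfl fun i _ => ?_
        simp only [lp.coeFn_smul, lp.coeFn_add, Pi.smul_apply, Pi.add_apply, smul_eq_mul]
        ring
      rw [h3]
      linarith
  set d : ℕ → ℝ := fun n => sInf ((fun f => ‖f‖ ^ 2) '' 𝒦 n) with hd
  have hbdd : ∀ n, BddBelow ((fun f => ‖f‖ ^ 2) '' 𝒦 n) := fun n =>
    ⟨0, by rintro _ ⟨f, -, rfl⟩; positivity⟩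
  have hne : ∀ n, ((fun f => ‖f‖ ^ 2) '' 𝒦 n).Nonempty := fun n => by
    obtain ⟨f, f0, -, f2⟩ := h n
    exact ⟨_, f, ⟨f0, f2⟩, rfl⟩
  have hdle : ∀ n, ∀ f ∈ 𝒦 n, d n ≤ ‖f‖ ^ 2 := fun n f hf => csInf_le (hbdd n) ⟨f, hf, rfl⟩
  have hdmono : Monotone d := fun m n hmn =>
    csInf_le_csInf (hbdd m) (hne n) (image_mono (hanti m n hmn))
  have hdR : ∀ n, d n ≤ R ^ 2 := fun n => by
    obtain ⟨f, f0, f1, f2⟩ := h n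
    exact (hdle n f ⟨f0, f2⟩).trans (by gcongr)
  obtain ⟨L, hL⟩ : ∃ L, Filter.Tendsto d Filter.atTop (nhds L) :=
    ⟨_, tendsto_atTop_ciSup hdmono ⟨R ^ 2, by rintro _ ⟨n, rfl⟩; exact hdR n⟩⟩
  have hLR : L ≤ R ^ 2 := le_of_tendsto' hL hdR
  have hdL : ∀ n, d n ≤ L := fun n => hdmono.ge_of_tendsto hL n
  set e : ℝ := (R' - R) / 3 with he
  have he0 : 0 < e := by rw [he]; linarith
  set η : ℕ → ℝ := fun j => (e * (1 / 2) ^ j) ^ 2 / 8 with hη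
  have hη0 : ∀ j, 0 < η j := fun j => by rw [hη]; positivity
  obtain ⟨φ, hφ, hφL⟩ := Filter.extraction_forall_of_eventually'
    (P := fun j n => L - η j < d n)
    (fun j => Filter.eventually_atTop.1
      (hL.eventually_const_lt (by linarith [hη0 j] : L - η j < L)))
  have hex : ∀ j, ∃ f ∈ 𝒦 (φ j), ‖f‖ ^ 2 < L + η j := fun j => by
    obtain ⟨_, ⟨f, hf, rfl⟩, hlt⟩ := exists_lt_of_csInf_lt (hne (φ j))
      (show sInf _ < L + η j from (hdL (φ j)).trans_lt (by linarith [hη0 j]))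
    exact ⟨f, hf, hlt⟩
  choose f hf𝒦 hfL using hex
  have hdiff : ∀ j, ‖f (j + 1) - f j‖ ≤ e * (1 / 2) ^ j := by
    intro j
    have h1 := hdle _ _ (hmid (φ j) (f (j + 1))
      (hanti _ _ (hφ.monotone (Nat.le_succ j)) (hf𝒦 (j + 1))) (f j) (hf𝒦 j))
    rw [norm_smul, mul_pow] at h1
    have h2 := parallelogram_law_with_norm ℝ (f (j + 1)) (f j)
    have h3 : η (j + 1) ≤ η j := by
      simp only [hη]
      gcongr ?_ ^ 2 / 8
      gcongr e * ?_
      exact pow_le_pow_of_le_one (by norm_num) (by norm_num) (Nat.le_succ j)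
    have h4 : ‖(1 / 2 : ℝ)‖ ^ 2 = 1 / 4 := by norm_num
    rw [h4] at h1
    refine (sq_le_sq₀ (norm_nonneg _) (by positivity)).1 ?_
    have h5 : (e * (1 / 2) ^ j) ^ 2 = 8 * η j := by simp only [hη]; ring
    rw [h5]
    nlinarith [hfL j, hfL (j + 1), hφL j]
  have hgeo : HasSum (fun j : ℕ => e * (1 / 2 : ℝ) ^ j) (e * 2) := hasSum_geometric_two.mul_left e
  have hsumm : Summable fun j => ‖lpAbs (f (j + 1) - f j)‖ :=
    Summable.of_nonneg_of_le (fun j => norm_nonneg _)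
      (fun j => (norm_lpAbs _).trans_le (hdiff j)) hgeo.summable
  set F := f 0 + ∑' j, lpAbs (f (j + 1) - f j) with hF
  have hFj : ∀ j i, f j i ≤ F i := by
    intro j i
    have ht : Filter.Tendsto
        (fun n => (f 0 + ∑ j ∈ Finset.range n, lpAbs (f (j + 1) - f j)) i) Filter.atTop
        (nhds (F i)) :=
      (((lp.lipschitzWith_one_eval 2 i).continuous.tendsto F).comp
        (hsumm.of_norm.hasSum.tendsto_sum_nat.const_add (f 0)))
    refine ge_of_tendsto ht (Filter.eventually_atTop.2 ⟨j, fun n hn => ?_⟩)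
    have key : ∀ m, f m i ≤ (f 0 + ∑ j ∈ Finset.range m, lpAbs (f (j + 1) - f j)) i := by
      intro m
      induction m with
      | zero => simp
      | succ m ih =>
        rw [Finset.sum_range_succ, ← add_assoc, lp.coeFn_add, Pi.add_apply, lpAbs_apply]
        have := le_abs_self ((f (m + 1) - f m) i)
        rw [lp.coeFn_sub, Pi.sub_apply] at this ⊢
        linarith
    refine (key j).trans ?_
    have hmon : Monotone fun m => (f 0 + ∑ j ∈ Finset.range m, lpAbs (f (j + 1) - f j)) i := by
      refine monotone_nat_of_le_succ fun m => ?_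
      rw [Finset.sum_range_succ, ← add_assoc, lp.coeFn_add _ (lpAbs _), Pi.add_apply, lpAbs_apply]
      exact le_add_of_nonneg_right (abs_nonneg _)
    exact hmon hn
  refine ⟨F, fun i => ((hf𝒦 0).1 i).trans (hFj 0 i), ?_, ?_⟩
  · have h1 : ‖f 0‖ ≤ R + e := by
      refine (sq_le_sq₀ (norm_nonneg _) (by positivity)).1 ?_
      have h2 : η 0 = e ^ 2 / 8 := by simp [hη]
      nlinarith [hfL 0]
    have h2 : ‖∑' j, lpAbs (f (j + 1) - f j)‖ ≤ e * 2 :=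
      tsum_of_norm_bounded hgeo fun j => (norm_lpAbs _).trans_le (hdiff j)
    refine (norm_add_le _ _).trans ((add_le_add h1 h2).trans ?_)
    rw [he]
    linarith
  · intro x hx c hc
    obtain ⟨n, hn⟩ := mem_iUnion.1 hx
    obtain ⟨S, hS⟩ := (hf𝒦 n).2 x (hE (hφ.id_le n) hn) c hc
    exact ⟨S, hS.trans_le (Finset.sum_le_sum fun i _ =>
      mul_le_mul_of_nonneg_right (hFj n i) (hg i x))⟩

/-- If a set has large capacity, some finitely supported probability on it has small energy. -/
lemma exists_energy_lt {g : ι → α → ℝ} (hg : ∀ i x, 0 ≤ g i x) {E : Set α} {R : ℝ} (hR : 0 < R)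
    (h : ¬ CapLE g E R) (S : Finset ι) :
    ∃ (κ : Type) (t : Finset κ) (w : κ → ℝ) (z : κ → α), (∀ k ∈ t, 0 ≤ w k) ∧
      ∑ k ∈ t, w k = 1 ∧ (∀ k ∈ t, z k ∈ E) ∧
      ∑ i ∈ S, (∑ k ∈ t, w k * g i (z k)) ^ 2 < (1 / R) ^ 2 := by
  classical
  set G : α → EuclideanSpace ℝ S := fun x => WithLp.toLp 2 fun i => g i x with hG
  set V := closure (convexHull ℝ (G '' E)) with hV
  have hEne : E.Nonempty := by
    by_contra hE
    rw [not_nonempty_iff_eq_empty] at hE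
    exact h (hE ▸ CapLE.empty g hR.le)
  have hVconv : Convex ℝ V := (convex_convexHull ℝ _).closure
  have hVne : V.Nonempty := ((hEne.image G).convexHull (𝕜 := ℝ)).closure
  obtain ⟨v, hvV, hv⟩ := exists_norm_eq_iInf_of_complete_convex hVne
    isClosed_closure.isComplete hVconv 0
  rw [norm_eq_iInf_iff_real_inner_le_zero hVconv hvV] at hv
  have hGV : ∀ x ∈ E, G x ∈ V := fun x hx =>
    subset_closure (subset_convexHull ℝ _ (mem_image_of_mem G hx))
  have hin : ∀ x ∈ E, ‖v‖ ^ 2 ≤ ∑ i : S, v i * g i x := by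
    intro x hx
    have h1 := hv (G x) (hGV x hx)
    rw [zero_sub, inner_neg_left, inner_sub_right, real_inner_self_eq_norm_sq] at h1
    have h2 : inner ℝ v (G x) = ∑ i : S, v i * g i x := by
      rw [PiLp.inner_apply]
      exact Finset.sum_congr rfl fun i _ => by simp [hG, mul_comm]
    linarith
  have hv0 : ∀ i, 0 ≤ v i := by
    have hcl : IsClosed {w : EuclideanSpace ℝ S | ∀ i, 0 ≤ w i} := by
      simp only [ofPred_forall]
      exact isClosed_iInter fun i => isClosed_le continuous_const (by fun_prop)
    have hcx : Convex ℝ {w : EuclideanSpace ℝ S | ∀ i, 0 ≤ w i} := by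
      intro a ha b hb p q hp hq _ i
      have := ha i
      have := hb i
      simp only [PiLp.add_apply, PiLp.smul_apply, smul_eq_mul]
      positivity
    refine (closure_minimal (convexHull_min ?_ hcx) hcl hvV : _)
    rintro _ ⟨x, -, rfl⟩ i
    exact hg i x
  have hvR : ‖v‖ < 1 / R := by
    by_contra! hcon
    have hvpos : 0 < ‖v‖ := lt_of_lt_of_le (by positivity) hcon
    apply h
    set a : ι → ℝ := fun i => if hi : i ∈ S then v ⟨i, hi⟩ / ‖v‖ ^ 2 else 0 with ha
    have haS : ∀ i : S, a i = v i / ‖v‖ ^ 2 := fun i => by simp [ha]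
    set f : lp (fun _ : ι => ℝ) 2 := ∑ i ∈ S, lp.single 2 i (a i) with hf
    have hfi : ∀ i, f i = a i := by
      intro i
      simp only [hf, lp.coeFn_sum, Finset.sum_apply, lp.single_apply]
      by_cases hi : i ∈ S
      · simp [Pi.single_apply, hi]
      · simp [Pi.single_apply, hi, ha]
    have hsq : ‖v‖ ^ 2 = ∑ i : S, v i ^ 2 := by
      rw [EuclideanSpace.norm_sq_eq]
      simp
    refine ⟨f, fun i => ?_, ?_, ?_⟩
    · rw [hfi]
      simp only [ha]
      split_ifs with hi
      · exact div_nonneg (hv0 _) (by positivity)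
      · exact le_rfl
    · have h1 := lp.norm_sum_single (E := fun _ : ι => ℝ) (p := 2) (by norm_num) a S
      rw [← hf] at h1
      have h2 : ‖f‖ ^ 2 = (1 / ‖v‖) ^ 2 := by
        have h3 : ‖f‖ ^ 2 = ∑ i ∈ S, ‖a i‖ ^ 2 := by
          have : (2 : ℝ≥0∞).toReal = (2 : ℕ) := by norm_num
          simpa only [this, Real.rpow_natCast] using h1
        rw [h3, ← Finset.sum_coe_sort]
        simp only [haS, Real.norm_eq_abs, sq_abs, div_pow]
        rw [← Finset.sum_div, ← hsq]
        field_simp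
      have h3 : ‖f‖ = 1 / ‖v‖ := (sq_eq_sq₀ (norm_nonneg _) (by positivity)).1 h2
      rw [h3, div_le_iff₀ hvpos]
      rwa [div_le_iff₀ hR, mul_comm] at hcon
    · intro x hx c hc
      refine ⟨S, hc.trans_le ?_⟩
      rw [← Finset.sum_coe_sort]
      simp only [hfi, haS, div_mul_eq_mul_div]
      rw [← Finset.sum_div, le_div_iff₀ (by positivity), one_mul]
      exact hin x hx
  obtain ⟨u, hu, huv⟩ := Metric.mem_closure_iff.1 hvV (1 / R - ‖v‖) (by linarith)
  have huR : ‖u‖ < 1 / R := by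
    have := norm_le_norm_add_norm_sub' u v
    rw [dist_eq_norm, norm_sub_rev] at huv
    linarith
  rw [convexHull_eq] at hu
  obtain ⟨κ, t, w, z, hw0, hw1, hz, hzu⟩ := hu
  have : Nonempty α := ⟨hEne.some⟩
  have hz' : ∀ k ∈ t, ∃ x, x ∈ E ∧ G x = z k := hz
  choose! y hyE hyz using hz'
  refine ⟨κ, t, w, y, hw0, hw1, hyE, ?_⟩
  have hui : ∀ i : S, u i = ∑ k ∈ t, w k * g i (y k) := by
    intro i
    rw [← hzu, Finset.centerMass_eq_of_sum_1 _ _ hw1]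
    rw [WithLp.ofLp_sum, Finset.sum_apply]
    refine Finset.sum_congr rfl fun k hk => ?_
    rw [← hyz k hk]
    simp [hG]
  rw [← Finset.sum_coe_sort]
  simp only [← hui]
  have : ‖u‖ ^ 2 = ∑ i : S, u i ^ 2 := by
    rw [EuclideanSpace.norm_sq_eq]
    simp
  rw [← this]
  gcongr

/-- Truncations of a point of a cylinder stay in the compact box. -/
lemma exists_cylinder_subset_of_box_subset (N : ℕ → ℕ) {V : Set (ℕ → ℕ)} (hV : IsOpen V)
    (h : {n : ℕ → ℕ | ∀ i, n i ≤ N i} ⊆ V) :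
    ∃ k, {n : ℕ → ℕ | ∀ i < k, n i ≤ N i} ⊆ V := by
  have hcomp : IsCompact {n : ℕ → ℕ | ∀ i, n i ≤ N i} := by
    have := isCompact_univ_pi (s := fun i => Set.Iic (N i)) fun i =>
      (Set.finite_Iic (N i)).isCompact
    convert this using 1
    ext n
    simp [Pi.le_def]
  by_contra! hcon
  have hex : ∀ k, ∃ n : ℕ → ℕ, (∀ i < k, n i ≤ N i) ∧ n ∉ V := fun k => by
    obtain ⟨n, hn, hnV⟩ := not_subset.1 (hcon k)
    exact ⟨n, hn, hnV⟩
  choose n hn hnV using hex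
  obtain ⟨b, hb, φ, hφ, hlim⟩ := hcomp.tendsto_subseq
    (x := fun k i => min (n k i) (N i)) (fun k i => min_le_right _ _)
  have hlim' : Filter.Tendsto (fun k => n (φ k)) Filter.atTop (nhds b) := by
    rw [tendsto_pi_nhds] at hlim ⊢
    intro i
    refine (hlim i).congr' ?_
    filter_upwards [Filter.eventually_gt_atTop i] with k hk
    exact min_eq_left (hn (φ k) i (hk.trans_le (hφ.id_le k)))
  obtain ⟨k, hk⟩ := (hlim'.eventually (hV.mem_nhds (h hb))).exists
  exact hnV _ hk

/-- Capacitability of analytic sets. -/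
lemma exists_isCompact_not_capLE [TopologicalSpace α] {g : ι → α → ℝ} (hg : ∀ i x, 0 ≤ g i x)
    (hgc : ∀ i, Continuous (g i)) {Y : Set α} (hY : AnalyticSet Y) {R R' : ℝ} (hR : 0 ≤ R)
    (hRR : R < R') (h : ¬ CapLE g Y R') : ∃ K ⊆ Y, IsCompact K ∧ ¬ CapLE g K R := by
  rw [AnalyticSet] at hY
  obtain rfl | ⟨F, hF, rfl⟩ := hY
  · exact absurd (CapLE.empty g (hR.trans hRR.le)) h
  obtain ⟨R₁, hR₁, hR₁'⟩ := exists_between hRR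
  set ρ : ℕ → ℝ := fun k => R₁ + (R' - R₁) * (1 / 2) ^ k with hρ
  have hρlt : ∀ k, ρ (k + 1) < ρ k := fun k => by
    have : 0 < (R' - R₁) * (1 / 2) ^ k := mul_pos (by linarith) (by positivity)
    simp only [hρ, pow_succ]
    linarith
  have hρge : ∀ k, R₁ < ρ k := fun k => by
    have : 0 < (R' - R₁) * (1 / 2) ^ k := mul_pos (by linarith) (by positivity)
    simp only [hρ]
    linarith
  set C : (ℕ → ℕ) → ℕ → Set (ℕ → ℕ) := fun N k => {n | ∀ i < k, n i ≤ N i} with hC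
  have hstep : ∀ (N : ℕ → ℕ) (k : ℕ), ∃ m, ¬ CapLE g (F '' C N k) (ρ k) →
      ¬ CapLE g (F '' C (Function.update N k m) (k + 1)) (ρ (k + 1)) := by
    intro N k
    by_contra! hcon
    refine (hcon 0).1 ?_
    have hmono : Monotone fun m => F '' C (Function.update N k m) (k + 1) := by
      intro a b hab
      refine image_mono fun n hn i hi => (hn i hi).trans ?_
      rcases eq_or_ne i k with rfl | hik
      · simpa using hab
      · simp [hik]
    refine (CapLE.iUnion hg hmono (fun m => (hcon m).2) (hρlt k)).mono ?_ le_rfl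
    rintro _ ⟨n, hn, rfl⟩
    refine mem_iUnion.2 ⟨n k, n, fun i hi => ?_, rfl⟩
    rcases eq_or_ne i k with rfl | hik
    · simp
    · simpa [hik] using hn i (by omega)
  choose m hm using hstep
  set s : ℕ → ℕ → ℕ := fun k => Nat.rec (fun _ => 0) (fun k N => Function.update N k (m N k)) k
    with hs
  have hs1 : ∀ k, s (k + 1) = Function.update (s k) k (m (s k) k) := fun k => rfl
  have hsC : ∀ k, ¬ CapLE g (F '' C (s k) k) (ρ k) := by
    intro k
    induction k with
    | zero =>
      have h1 : F '' C (s 0) 0 = range F := by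
        rw [← image_univ]
        congr 1
        ext n
        simp [hC]
      have h2 : ρ 0 = R' := by simp [hρ]
      rwa [h1, h2]
    | succ k ih => rw [hs1]; exact hm _ _ ih
  set N : ℕ → ℕ := fun k => s (k + 1) k with hN
  have hsN : ∀ k, ∀ i < k, s k i = N i := by
    intro k
    induction k with
    | zero => intro i hi; omega
    | succ k ih =>
      intro i hi
      rcases eq_or_ne i k with rfl | hik
      · rfl
      · rw [hs1, Function.update_of_ne hik]
        exact ih i (by omega)
  have hCN : ∀ k, C (s k) k = C N k := fun k => by
    ext n
    exact forall₂_congr fun i hi => by rw [hsN k i hi]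
  refine ⟨F '' {n | ∀ i, n i ≤ N i}, image_subset_range _ _, ?_, fun hK => ?_⟩
  · refine IsCompact.image ?_ hF
    convert isCompact_univ_pi (s := fun i => Set.Iic (N i)) fun i =>
      (Set.finite_Iic (N i)).isCompact using 1
    ext n
    simp [Pi.le_def]
  · obtain ⟨U, hU, hKU, hcap⟩ := hK.exists_isOpen hgc hR₁
    obtain ⟨k, hk⟩ := exists_cylinder_subset_of_box_subset N (hU.preimage hF)
      (image_subset_iff.1 hKU)
    refine hsC k (hcap.mono ?_ (hρge k).le)
    rw [hCN, image_subset_iff]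
    exact hk

end Capacity

section Tent

lemma ediam_closedBall_le_ofReal {X : Type*} [PseudoMetricSpace X] (x : X) (r : ℝ) :
    ediam (closedBall x r) ≤ ENNReal.ofReal (2 * r) := by
  refine ediam_le_of_forall_dist_le fun y hy z hz => ?_
  have := dist_triangle_right y z x
  rw [mem_closedBall] at hy hz
  linarith

/-- Dyadic tent functions on the plane, normalised so that their `ℓ²`-kernel is comparable to the
Riesz kernel of exponent `s`. -/
def tent (s : ℝ) (i : ℕ × ℤ × ℤ) (z : ℝ × ℝ) : ℝ :=
  (2 : ℝ) ^ ((i.1 : ℝ) * s / 2) *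
    max 0 (1 - ‖(2 : ℝ) ^ i.1 • z - ((i.2.1 : ℝ), (i.2.2 : ℝ))‖)

lemma tent_nonneg (s : ℝ) (i : ℕ × ℤ × ℤ) (z : ℝ × ℝ) : 0 ≤ tent s i z := by
  unfold tent
  positivity

lemma continuous_tent (s : ℝ) (i : ℕ × ℤ × ℤ) : Continuous (tent s i) := by
  unfold tent
  fun_prop

lemma tent_le (s : ℝ) (i : ℕ × ℤ × ℤ) (z : ℝ × ℝ) : tent s i z ≤ 2 ^ ((i.1 : ℝ) * s / 2) := by
  unfold tent
  refine mul_le_of_le_one_right (by positivity) (max_le zero_le_one ?_)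
  linarith [norm_nonneg ((2 : ℝ) ^ i.1 • z - ((i.2.1 : ℝ), (i.2.2 : ℝ)))]

lemma norm_sub_lt_one_of_tent_ne_zero {s : ℝ} {i : ℕ × ℤ × ℤ} {z : ℝ × ℝ} (h : tent s i z ≠ 0) :
    ‖(2 : ℝ) ^ i.1 • z - ((i.2.1 : ℝ), (i.2.2 : ℝ))‖ < 1 := by
  by_contra! hcon
  exact h (by rw [tent, max_eq_left (by linarith), mul_zero])

lemma mem_closedBall_of_tent_ne_zero {s : ℝ} {i : ℕ × ℤ × ℤ} {z : ℝ × ℝ} (h : tent s i z ≠ 0) :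
    z ∈ closedBall (((2 : ℝ) ^ i.1)⁻¹ • ((i.2.1 : ℝ), (i.2.2 : ℝ))) ((2 : ℝ) ^ i.1)⁻¹ := by
  have h1 := norm_sub_lt_one_of_tent_ne_zero h
  have h2 : (0 : ℝ) < 2 ^ i.1 := by positivity
  have h3 : z - ((2 : ℝ) ^ i.1)⁻¹ • ((i.2.1 : ℝ), (i.2.2 : ℝ)) =
      ((2 : ℝ) ^ i.1)⁻¹ • ((2 : ℝ) ^ i.1 • z - ((i.2.1 : ℝ), (i.2.2 : ℝ))) := by
    rw [smul_sub, inv_smul_smul₀ h2.ne']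
  rw [mem_closedBall, dist_eq_norm, h3, norm_smul, Real.norm_of_nonneg (by positivity)]
  exact mul_le_of_le_one_right (by positivity) h1.le

lemma floor_sub_mem_of_abs_sub_lt {u : ℝ} {a : ℤ} (h : |u - a| < 1) :
    a - ⌊u⌋ ∈ Finset.Icc (0 : ℤ) 1 := by
  rw [abs_lt] at h
  have h1 := Int.floor_le u
  have h2 := Int.lt_floor_add_one u
  have h3 : a < ⌊u⌋ + 2 := by exact_mod_cast (by linarith : (a : ℝ) < ⌊u⌋ + 2)
  have h4 : ⌊u⌋ - 1 < a := by exact_mod_cast (by linarith : (⌊u⌋ : ℝ) - 1 < a)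
  rw [Finset.mem_Icc]
  omega

/-- At most four tents of a given scale meet a point, so their weights add up geometrically. -/
lemma sum_geometric_tent_le (s : ℝ) (z : ℝ × ℝ) {q : ℝ} (hq0 : 0 ≤ q) (hq1 : q < 1)
    (S : Finset (ℕ × ℤ × ℤ)) (hS : ∀ i ∈ S, tent s i z ≠ 0) :
    ∑ i ∈ S, q ^ i.1 ≤ 4 / (1 - q) := by
  classical
  set Φ : ℕ × ℤ × ℤ → ℕ × ℤ × ℤ := fun i =>
    (i.1, i.2.1 - ⌊(2 : ℝ) ^ i.1 * z.1⌋, i.2.2 - ⌊(2 : ℝ) ^ i.1 * z.2⌋) with hΦ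
  have hinj : InjOn Φ S := by
    rintro ⟨n, a, b⟩ - ⟨n', a', b'⟩ - h
    simp only [hΦ, Prod.mk.injEq] at h
    obtain ⟨rfl, h1, h2⟩ := h
    simp only [sub_left_inj] at h1 h2
    rw [h1, h2]
  set M := S.sup (fun i => i.1) + 1 with hM
  have hsub : S.image Φ ⊆ Finset.range M ×ˢ (Finset.Icc (0 : ℤ) 1 ×ˢ Finset.Icc (0 : ℤ) 1) := by
    intro j hj
    obtain ⟨i, hi, rfl⟩ := Finset.mem_image.1 hj
    have h1 := norm_sub_lt_one_of_tent_ne_zero (hS i hi)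
    rw [Prod.norm_def, max_lt_iff] at h1
    simp only [Prod.fst_sub, Prod.snd_sub, Prod.smul_fst, Prod.smul_snd, smul_eq_mul,
      Real.norm_eq_abs] at h1
    rw [Finset.mem_product, Finset.mem_product, Finset.mem_range]
    have h2 : i.1 ≤ S.sup fun i => i.1 := Finset.le_sup (f := fun i : ℕ × ℤ × ℤ => i.1) hi
    exact ⟨Nat.lt_succ_of_le h2,
      floor_sub_mem_of_abs_sub_lt h1.1, floor_sub_mem_of_abs_sub_lt h1.2⟩
  calc ∑ i ∈ S, q ^ i.1 = ∑ j ∈ S.image Φ, q ^ j.1 := by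
        rw [Finset.sum_image hinj]
    _ ≤ ∑ j ∈ Finset.range M ×ˢ (Finset.Icc (0 : ℤ) 1 ×ˢ Finset.Icc (0 : ℤ) 1), q ^ j.1 :=
        Finset.sum_le_sum_of_subset_of_nonneg hsub fun _ _ _ => by positivity
    _ = 4 * ∑ n ∈ Finset.range M, q ^ n := by
        rw [Finset.sum_product, Finset.mul_sum]
        refine Finset.sum_congr rfl fun n _ => ?_
        simp
    _ ≤ 4 * (1 - q)⁻¹ := by
        gcongr
        rw [← tsum_geometric_of_lt_one hq0 hq1]
        exact (summable_geometric_of_lt_one hq0 hq1).sum_le_tsum _ fun _ _ => by positivity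
    _ = 4 / (1 - q) := by rw [div_eq_mul_inv]

/-- Sets of zero capacity have small Hausdorff dimension. -/
lemma dimH_le_of_forall_capLE_tent {s : ℝ} (hs : 0 ≤ s) {E : Set (ℝ × ℝ)}
    (h : ∀ R > 0, CapLE (tent s) E R) : dimH E ≤ ENNReal.ofReal s := by
  refine le_of_forall_gt_imp_ge_of_dense fun d hd => ?_
  obtain ⟨s', hs', hs'd⟩ := ENNReal.lt_iff_exists_nnreal_btwn.1 hd
  refine le_trans ?_ hs'd.le
  refine dimH_le_of_hausdorffMeasure_ne_top ?_
  have hss : s < s' := by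
    rw [← ENNReal.ofReal_coe_nnreal] at hs'
    exact (ENNReal.ofReal_lt_ofReal_iff_of_nonneg hs).1 hs'
  have hs'0 : (0 : ℝ) < s' := hs.trans_lt hss
  set q : ℝ := 2 ^ (-((s' - s) / 2)) with hq
  have hq0 : 0 < q := by positivity
  have hq1 : q < 1 := Real.rpow_lt_one_of_one_lt_of_neg (by norm_num) (by linarith)
  have hqpow : ∀ n : ℕ, q ^ n = 2 ^ (-((n : ℝ) * (s' - s) / 2)) := fun n => by
    rw [hq, ← Real.rpow_natCast, ← Real.rpow_mul (by norm_num)]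
    congr 1
    ring
  set c : ℝ := (1 - q) / 8 with hc
  have hc0 : 0 < c := by rw [hc]; linarith
  set R : ℕ → ℝ := fun m => c * (1 / (2 * (m + 1))) ^ ((s' : ℝ) / 2) with hR
  have hR0 : ∀ m, 0 < R m := fun m => by rw [hR]; positivity
  have hRsq : ∀ m, (R m / c) ^ 2 = (1 / (2 * ((m : ℝ) + 1))) ^ (s' : ℝ) := fun m => by
    simp only [hR]
    rw [mul_div_cancel_left₀ _ hc0.ne', ← Real.rpow_natCast, ← Real.rpow_mul (by positivity)]
    congr 1
    push_cast
    ring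
  choose f hf0 hfR hfE using fun m => h (R m) (hR0 m)
  set I : ℕ → Set (ℕ × ℤ × ℤ) := fun m => {i | c * q ^ i.1 ≤ f m i * 2 ^ ((i.1 : ℝ) * s / 2)}
    with hI
  classical
  set D : ℕ → ℕ × ℤ × ℤ → Set (ℝ × ℝ) := fun m i => if i ∈ I m then
    closedBall (((2 : ℝ) ^ i.1)⁻¹ • ((i.2.1 : ℝ), (i.2.2 : ℝ))) ((2 : ℝ) ^ i.1)⁻¹ else ∅ with hD
  have hcov : ∀ m, E ⊆ ⋃ i, D m i := by
    intro m x hx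
    by_contra hcon
    simp only [mem_iUnion, not_exists] at hcon
    obtain ⟨S, hS⟩ := hfE m x hx (1 / 2) (by norm_num)
    have hbad : ∀ i, tent s i x ≠ 0 → f m i * 2 ^ ((i.1 : ℝ) * s / 2) ≤ c * q ^ i.1 := by
      intro i hi
      by_contra! hlt
      refine hcon i ?_
      have : i ∈ I m := hlt.le
      simp only [hD, if_pos this]
      exact mem_closedBall_of_tent_ne_zero hi
    have h1 : ∑ i ∈ S, f m i * tent s i x ≤ ∑ i ∈ S with tent s i x ≠ 0, c * q ^ i.1 := by
      rw [Finset.sum_filter]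
      refine Finset.sum_le_sum fun i _ => ?_
      split_ifs with hi
      · exact (mul_le_mul_of_nonneg_left (tent_le s i x) (hf0 m i)).trans (hbad i hi)
      · rw [not_not] at hi
        rw [hi, mul_zero]
    rw [← Finset.mul_sum] at h1
    have h2 := sum_geometric_tent_le s x hq0.le hq1 (S.filter fun i => tent s i x ≠ 0)
      fun i hi => (Finset.mem_filter.1 hi).2
    have h3 : c * (4 / (1 - q)) = 1 / 2 := by
      have : 1 - q ≠ 0 := by linarith
      rw [hc]
      field_simp
      norm_num
    have h4 := mul_le_mul_of_nonneg_left h2 hc0.le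
    linarith
  have hweight : ∀ m i, i ∈ I m → ((2 : ℝ) ^ i.1)⁻¹ ^ (s' : ℝ) ≤ (f m i / c) ^ 2 := by
    intro m i hi
    have h1 : c * q ^ i.1 ≤ f m i * 2 ^ ((i.1 : ℝ) * s / 2) := hi
    have h2 : ((2 : ℝ) ^ i.1)⁻¹ ^ (s' : ℝ) = (q ^ i.1 / 2 ^ ((i.1 : ℝ) * s / 2)) ^ 2 := by
      rw [hqpow, ← Real.rpow_sub (by norm_num), ← Real.rpow_natCast, ← Real.rpow_natCast,
        ← Real.rpow_neg (by norm_num), ← Real.rpow_mul (by norm_num), ← Real.rpow_mul (by norm_num)]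
      congr 1
      push_cast
      ring
    rw [h2]
    refine pow_le_pow_left₀ (by positivity) ?_ 2
    rw [div_le_div_iff₀ (by positivity) hc0]
    linarith
  have hfsq : ∀ m, HasSum (fun i => f m i ^ 2) (‖f m‖ ^ 2) := by
    intro m
    have := lp.hasSum_norm (p := 2) (by norm_num) (f m)
    have h2 : (2 : ℝ≥0∞).toReal = (2 : ℕ) := by norm_num
    simpa only [h2, Real.rpow_natCast, Real.norm_eq_abs, sq_abs] using this
  have hfsq1 : ∀ m i, (f m i / c) ^ 2 ≤ (1 / (2 * ((m : ℝ) + 1))) ^ (s' : ℝ) := by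
    intro m i
    rw [← hRsq]
    have h1 : f m i ≤ R m := by
      have := lp.norm_apply_le_norm (p := 2) (by norm_num) (f m) i
      rw [Real.norm_eq_abs] at this
      exact (le_abs_self _).trans (this.trans (hfR m))
    have := hf0 m i
    gcongr
  have hdiam : ∀ m i, ediam (D m i) ≤ ENNReal.ofReal (1 / ((m : ℝ) + 1)) := by
    intro m i
    simp only [hD]
    split_ifs with hi
    · have h1 := (hweight m i hi).trans (hfsq1 m i)
      have h2 := (Real.rpow_le_rpow_iff (by positivity) (by positivity) hs'0).1 h1
      refine (ediam_closedBall_le_ofReal _ _).trans ?_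
      refine ENNReal.ofReal_le_ofReal ?_
      calc 2 * ((2 : ℝ) ^ i.1)⁻¹ ≤ 2 * (1 / (2 * ((m : ℝ) + 1))) := by gcongr
        _ = _ := by field_simp
    · simp
  have hsum : ∀ m, ∑' i, ediam (D m i) ^ (s' : ℝ) ≤ ENNReal.ofReal (2 ^ (s' : ℝ)) := by
    intro m
    have h1 : ∀ i, ediam (D m i) ^ (s' : ℝ) ≤ ENNReal.ofReal (2 ^ (s' : ℝ) / c ^ 2 * f m i ^ 2) := by
      intro i
      simp only [hD]
      split_ifs with hi
      · have h2 : ediam (closedBall (((2 : ℝ) ^ i.1)⁻¹ • ((i.2.1 : ℝ), (i.2.2 : ℝ)))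
            ((2 : ℝ) ^ i.1)⁻¹) ≤ ENNReal.ofReal (2 * ((2 : ℝ) ^ i.1)⁻¹) :=
          ediam_closedBall_le_ofReal _ _
        refine (ENNReal.rpow_le_rpow h2 hs'0.le).trans ?_
        rw [ENNReal.ofReal_rpow_of_nonneg (by positivity) hs'0.le]
        refine ENNReal.ofReal_le_ofReal ?_
        rw [Real.mul_rpow (by norm_num) (by positivity)]
        calc _ ≤ (2 : ℝ) ^ (s' : ℝ) * (f m i / c) ^ 2 := by gcongr; exact hweight m i hi
          _ = _ := by rw [div_pow (f m i) c]; ring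
      · simp [ENNReal.zero_rpow_of_pos hs'0]
    refine (ENNReal.tsum_le_tsum h1).trans ?_
    have h3 := (hfsq m).mul_left (2 ^ (s' : ℝ) / c ^ 2)
    rw [← ENNReal.ofReal_tsum_of_nonneg (fun i => by positivity) h3.summable, h3.tsum_eq]
    refine ENNReal.ofReal_le_ofReal ?_
    have h4 : (‖f m‖ / c) ^ 2 ≤ 1 := by
      calc (‖f m‖ / c) ^ 2 ≤ (R m / c) ^ 2 := by gcongr; exact hfR m
        _ = _ := hRsq m
        _ ≤ 1 := by
          refine Real.rpow_le_one (by positivity) ?_ hs'0.le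
          rw [div_le_one (by positivity)]
          linarith [(Nat.cast_nonneg m : (0 : ℝ) ≤ m)]
    calc (2 : ℝ) ^ (s' : ℝ) / c ^ 2 * ‖f m‖ ^ 2 = 2 ^ (s' : ℝ) * (‖f m‖ / c) ^ 2 := by
          rw [div_pow ‖f m‖ c, div_mul_eq_mul_div, mul_div_assoc]
      _ ≤ 2 ^ (s' : ℝ) * 1 := by gcongr
      _ = _ := mul_one _
  have hr : Filter.Tendsto (fun m : ℕ => ENNReal.ofReal (1 / ((m : ℝ) + 1))) Filter.atTop
      (nhds 0) := by
    simpa using ENNReal.tendsto_ofReal (tendsto_one_div_add_atTop_nhds_zero_nat (𝕜 := ℝ))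
  have hfin := Measure.hausdorffMeasure_le_liminf_tsum (s' : ℝ) E _ hr D
    (Filter.Eventually.of_forall hdiam) (Filter.Eventually.of_forall hcov)
  have hfin' : Filter.liminf (fun m => ∑' i, ediam (D m i) ^ (s' : ℝ)) Filter.atTop ≤
      ENNReal.ofReal (2 ^ (s' : ℝ)) := by
    refine (Filter.liminf_le_liminf (Filter.Eventually.of_forall hsum)).trans ?_
    rw [Filter.liminf_const]
  exact ne_top_of_le_ne_top ENNReal.ofReal_ne_top (hfin.trans hfin')

/-- The tent kernel dominates the dyadically truncated Riesz kernel. -/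
lemma exists_finset_le_sum_tent_mul_tent {s : ℝ} (hs0 : 0 ≤ s) (hs2 : s ≤ 2) (L : ℝ) (N : ℕ) :
    ∃ S : Finset (ℕ × ℤ × ℤ), ∀ x x' : ℝ × ℝ, ‖x‖ ≤ L → ‖x - x'‖ ≤ 1 / 4 → ∀ k ≤ N,
      (max ‖x - x'‖ ((2 : ℝ) ^ k)⁻¹) ^ (-s) / 512 ≤ ∑ i ∈ S, tent s i x * tent s i x' := by
  set W : ℤ := ⌈(2 : ℝ) ^ N * L⌉ + 1 with hW
  refine ⟨Finset.range (N + 1) ×ˢ (Finset.Icc (-W) W ×ˢ Finset.Icc (-W) W), ?_⟩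
  intro x x' hx hxx k hk
  have hround : ∀ (n : ℕ) (u : ℝ), n ≤ N → |u| ≤ L →
      round ((2 : ℝ) ^ n * u) ∈ Finset.Icc (-W) W := by
    intro n u hn hu
    have h1 := abs_sub_round ((2 : ℝ) ^ n * u)
    have h2 : |(2 : ℝ) ^ n * u| ≤ 2 ^ N * L := by
      rw [abs_mul, abs_of_pos (by positivity : (0 : ℝ) < 2 ^ n)]
      have : (0 : ℝ) ≤ L := (abs_nonneg _).trans hu
      gcongr
      norm_num
    have h3 := Int.le_ceil ((2 : ℝ) ^ N * L)
    rw [abs_le] at h1 h2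
    rw [Finset.mem_Icc]
    constructor
    · have : ((-W : ℤ) : ℝ) ≤ round ((2 : ℝ) ^ n * u) := by
        rw [hW]; push_cast; linarith
      exact_mod_cast this
    · have : (round ((2 : ℝ) ^ n * u) : ℝ) ≤ (W : ℤ) := by
        rw [hW]; push_cast; linarith
      exact_mod_cast this
  have hscale : ∀ n ≤ N, ‖x - x'‖ ≤ ((2 : ℝ) ^ n)⁻¹ / 4 →
      (2 : ℝ) ^ (n * s) / 8 ≤ ∑ i ∈ Finset.range (N + 1) ×ˢ
        (Finset.Icc (-W) W ×ˢ Finset.Icc (-W) W), tent s i x * tent s i x' := by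
    intro n hn hnx
    set i : ℕ × ℤ × ℤ := (n, round ((2 : ℝ) ^ n * x.1), round ((2 : ℝ) ^ n * x.2)) with hi
    have hmem : i ∈ Finset.range (N + 1) ×ˢ (Finset.Icc (-W) W ×ˢ Finset.Icc (-W) W) := by
      simp only [Finset.mem_product, hi]
      exact ⟨Finset.mem_range.2 (by omega), hround n _ hn ((norm_fst_le x).trans hx),
        hround n _ hn ((norm_snd_le x).trans hx)⟩
    refine le_trans ?_ (Finset.single_le_sum (f := fun i => tent s i x * tent s i x')
      (fun j _ => mul_nonneg (tent_nonneg s j x) (tent_nonneg s j x')) hmem)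
    have h1 : ‖(2 : ℝ) ^ i.1 • x - ((i.2.1 : ℝ), (i.2.2 : ℝ))‖ ≤ 1 / 2 :=
      max_le (abs_sub_round _) (abs_sub_round _)
    have h2 : ‖(2 : ℝ) ^ i.1 • x' - ((i.2.1 : ℝ), (i.2.2 : ℝ))‖ ≤ 3 / 4 := by
      have h3 : (2 : ℝ) ^ i.1 • x' - ((i.2.1 : ℝ), (i.2.2 : ℝ)) =
          ((2 : ℝ) ^ i.1 • x - ((i.2.1 : ℝ), (i.2.2 : ℝ))) - (2 : ℝ) ^ i.1 • (x - x') := by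
        rw [smul_sub]; abel
      rw [h3]
      refine (norm_sub_le _ _).trans ?_
      have h4 : ‖(2 : ℝ) ^ i.1 • (x - x')‖ ≤ 1 / 4 := by
        rw [norm_smul, Real.norm_of_nonneg (by positivity)]
        calc (2 : ℝ) ^ i.1 * ‖x - x'‖ ≤ 2 ^ n * (((2 : ℝ) ^ n)⁻¹ / 4) := by gcongr
          _ = 1 / 4 := by field_simp
      linarith
    have h5 : (2 : ℝ) ^ (n * s) = 2 ^ ((i.1 : ℝ) * s / 2) * 2 ^ ((i.1 : ℝ) * s / 2) := by
      rw [← Real.rpow_add (by norm_num)]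
      congr 1
      simp only [hi]
      ring
    have h6 : (2 : ℝ) ^ ((i.1 : ℝ) * s / 2) * (1 / 2) ≤ tent s i x := by
      unfold tent
      gcongr
      exact le_max_of_le_right (by linarith)
    have h7 : (2 : ℝ) ^ ((i.1 : ℝ) * s / 2) * (1 / 4) ≤ tent s i x' := by
      unfold tent
      gcongr
      exact le_max_of_le_right (by linarith)
    calc (2 : ℝ) ^ (n * s) / 8 = (2 : ℝ) ^ ((i.1 : ℝ) * s / 2) * (1 / 2) *
          ((2 : ℝ) ^ ((i.1 : ℝ) * s / 2) * (1 / 4)) := by rw [h5]; ring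
      _ ≤ _ := mul_le_mul h6 h7 (by positivity) (tent_nonneg s i x)
  set ρ : ℝ := max (4 * ‖x - x'‖) ((2 : ℝ) ^ k)⁻¹ with hρ
  have hρ0 : 0 < ρ := lt_max_of_lt_right (by positivity)
  have hρ1 : ρ ≤ 1 := max_le (by linarith) (inv_le_one_of_one_le₀ (one_le_pow₀ (by norm_num)))
  obtain ⟨n, hn1, hn2⟩ := exists_nat_pow_near_of_lt_one hρ0 hρ1
    (by norm_num : (0 : ℝ) < 1 / 2) (by norm_num : (1 / 2 : ℝ) < 1)
  rw [one_div, inv_pow] at hn1 hn2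
  have hnk : n ≤ k := by
    have h1 : ((2 : ℝ) ^ k)⁻¹ ≤ ((2 : ℝ) ^ n)⁻¹ := (le_max_right _ _).trans hn2
    rw [inv_le_inv₀ (by positivity) (by positivity)] at h1
    exact (pow_le_pow_iff_right₀ (by norm_num)).1 h1
  refine le_trans ?_ (hscale n (hnk.trans hk) ?_)
  · have h1 : ((2 : ℝ) ^ n)⁻¹ ≤ 8 * max ‖x - x'‖ ((2 : ℝ) ^ k)⁻¹ := by
      have h2 : ρ ≤ 4 * max ‖x - x'‖ ((2 : ℝ) ^ k)⁻¹ := by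
        refine max_le (by gcongr; exact le_max_left _ _) ?_
        have := le_max_right ‖x - x'‖ ((2 : ℝ) ^ k)⁻¹
        have : (0 : ℝ) < ((2 : ℝ) ^ k)⁻¹ := by positivity
        linarith
      have h3 : ((2 : ℝ) ^ (n + 1))⁻¹ = ((2 : ℝ) ^ n)⁻¹ / 2 := by rw [pow_succ]; field_simp
      linarith
    have h4 : (0 : ℝ) < max ‖x - x'‖ ((2 : ℝ) ^ k)⁻¹ := lt_max_of_lt_right (by positivity)
    have h5 : (8 * max ‖x - x'‖ ((2 : ℝ) ^ k)⁻¹) ^ (-s) ≤ (((2 : ℝ) ^ n)⁻¹) ^ (-s) :=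
      Real.rpow_le_rpow_of_nonpos (by positivity) h1 (by linarith)
    have h6 : (((2 : ℝ) ^ n)⁻¹) ^ (-s) = 2 ^ (n * s) := by
      rw [Real.inv_rpow (by positivity), ← Real.rpow_natCast, ← Real.rpow_mul (by norm_num),
        ← Real.rpow_neg (by norm_num)]
      congr 1
      ring
    have h7 : (1 / 64 : ℝ) ≤ 8 ^ (-s) := by
      rw [Real.rpow_neg (by norm_num), one_div]
      refine inv_anti₀ (by positivity) ?_
      calc (8 : ℝ) ^ s ≤ 8 ^ (2 : ℝ) := Real.rpow_le_rpow_of_exponent_le (by norm_num) hs2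
        _ = 64 := by norm_num
    rw [Real.mul_rpow (by norm_num) h4.le, h6] at h5
    have h8 : (1 / 64 : ℝ) * max ‖x - x'‖ ((2 : ℝ) ^ k)⁻¹ ^ (-s) ≤
        8 ^ (-s) * max ‖x - x'‖ ((2 : ℝ) ^ k)⁻¹ ^ (-s) := by gcongr
    linarith
  · have := (le_max_left _ _).trans hn2
    linarith

/-- A bounded set of large capacity carries finitely supported probabilities whose truncated Riesz
energies are bounded at all scales down to `2 ^ (-N)`. -/
lemma exists_rieszEnergy_le {s : ℝ} (hs0 : 0 ≤ s) (hs2 : s ≤ 2) {E : Set (ℝ × ℝ)} {L : ℝ}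
    (hL : ∀ x ∈ E, ‖x‖ ≤ L) (hd : ∀ x ∈ E, ∀ y ∈ E, ‖x - y‖ ≤ 1 / 4) {R : ℝ} (hR : 0 < R)
    (h : ¬ CapLE (tent s) E R) (N : ℕ) :
    ∃ (κ : Type) (t : Finset κ) (w : κ → ℝ) (z : κ → ℝ × ℝ), (∀ i ∈ t, 0 ≤ w i) ∧
      ∑ i ∈ t, w i = 1 ∧ (∀ i ∈ t, z i ∈ E) ∧ ∀ k ≤ N,
      ∑ i ∈ t, ∑ j ∈ t, w i * w j * (max ‖z i - z j‖ ((2 : ℝ) ^ k)⁻¹) ^ (-s) ≤ 512 / R ^ 2 := by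
  obtain ⟨S, hS⟩ := exists_finset_le_sum_tent_mul_tent hs0 hs2 L N
  obtain ⟨κ, t, w, z, hw0, hw1, hz, hen⟩ := exists_energy_lt (tent_nonneg s) hR h S
  refine ⟨κ, t, w, z, hw0, hw1, hz, fun k hk => ?_⟩
  have h1 : ∑ i ∈ t, ∑ j ∈ t, w i * w j * ((max ‖z i - z j‖ ((2 : ℝ) ^ k)⁻¹) ^ (-s) / 512) ≤
      ∑ a ∈ S, (∑ i ∈ t, w i * tent s a (z i)) ^ 2 := by
    calc _ ≤ ∑ i ∈ t, ∑ j ∈ t, w i * w j * ∑ a ∈ S, tent s a (z i) * tent s a (z j) := by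
          refine Finset.sum_le_sum fun i hi => Finset.sum_le_sum fun j hj => ?_
          refine mul_le_mul_of_nonneg_left ?_ (mul_nonneg (hw0 i hi) (hw0 j hj))
          exact hS _ _ (hL _ (hz i hi)) (hd _ (hz i hi) _ (hz j hj)) k hk
      _ = _ := by
          simp only [sq, Finset.sum_mul_sum]
          rw [Finset.sum_comm]
          simp only [Finset.mul_sum]
          rw [Finset.sum_comm]
          refine Eq.trans (Finset.sum_congr rfl fun i _ => Finset.sum_comm) ?_
          rw [Finset.sum_comm]
          refine Finset.sum_congr rfl fun a _ => ?_
          rw [Finset.sum_comm]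
          refine Finset.sum_congr rfl fun i _ => Finset.sum_congr rfl fun j _ => ?_
          ring
  have h2 : ∑ i ∈ t, ∑ j ∈ t, w i * w j * (max ‖z i - z j‖ ((2 : ℝ) ^ k)⁻¹) ^ (-s) =
      512 * ∑ i ∈ t, ∑ j ∈ t, w i * w j * ((max ‖z i - z j‖ ((2 : ℝ) ^ k)⁻¹) ^ (-s) / 512) := by
    simp only [Finset.mul_sum]
    refine Finset.sum_congr rfl fun i _ => Finset.sum_congr rfl fun j _ => ?_
    ring
  rw [h2]
  calc _ ≤ 512 * (1 / R) ^ 2 := by gcongr; exact h1.trans hen.le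
    _ = _ := by rw [div_pow, one_pow]; ring

end Tent

section KatzTao

lemma exists_cover_of_hausdorffMeasure_eq_zero {σ : ℝ} {A : Set ℝ} (hA : μH[σ] A = 0)
    {ε : ℝ≥0∞} (hε : ε ≠ 0) :
    ∃ U : ℕ → Set ℝ, A ⊆ ⋃ n, U n ∧ (∀ n, ediam (U n) ≤ 1) ∧
      ∑' n, ⨆ _ : (U n).Nonempty, ediam (U n) ^ σ < ε := by
  rw [Measure.hausdorffMeasure_apply] at hA
  have h1 := le_iSup₂ (f := fun (r : ℝ≥0∞) (_ : 0 < r) =>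
    ⨅ (t : ℕ → Set ℝ) (_ : A ⊆ ⋃ n, t n) (_ : ∀ n, ediam (t n) ≤ r),
      ∑' n, ⨆ _ : (t n).Nonempty, ediam (t n) ^ σ) 1 one_pos
  rw [hA] at h1
  have h2 := lt_of_le_of_lt h1 (pos_iff_ne_zero.2 hε)
  simp only [iInf_lt_iff] at h2
  obtain ⟨t, ht1, ht2, ht3⟩ := h2
  exact ⟨t, ht1, ht2, ht3⟩

/-- A null set for the `σ`-dimensional Hausdorff measure is covered by pieces `𝒜 k`, `k ≥ k₀`,
whose neighbourhoods of radius comparable to `2 ^ (-k)` have at most `σ`-dimensional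
concentration on balls. -/
lemma exists_nonconcentrated_cover {σ : ℝ} (hσ0 : 0 < σ) (hσ1 : σ ≤ 1) {A : Set ℝ}
    (hA : μH[σ] A = 0) (k₀ : ℕ) :
    ∃ 𝒜 : ℕ → Set ℝ, (∀ a ∈ A, ∃ k ≥ k₀, a ∈ 𝒜 k) ∧
      ∀ (k : ℕ) (c ρ : ℝ), ((2 : ℝ) ^ k)⁻¹ ≤ ρ →
        volume (cthickening (2 * ((2 : ℝ) ^ k)⁻¹) (𝒜 k) ∩ closedBall c ρ) ≤
          ENNReal.ofReal (256 * (((2 : ℝ) ^ k)⁻¹ ^ (1 - σ) * ρ ^ σ)) := by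
  classical
  set δ : ℕ → ℝ := fun k => ((2 : ℝ) ^ k)⁻¹ with hδ
  have hδ0 : ∀ k, 0 < δ k := fun k => by positivity
  have hδanti : ∀ {j k}, j ≤ k → δ k ≤ δ j := fun {j k} hjk =>
    inv_anti₀ (by positivity) (pow_le_pow_right₀ (by norm_num) hjk)
  set θ : ℕ → ℝ≥0∞ := fun k => ENNReal.ofReal (δ k ^ σ) with hθ
  have hθ0 : ∀ k, θ k ≠ 0 := fun k => by
    have := hδ0 k
    simp only [hθ, ne_eq, ENNReal.ofReal_eq_zero, not_le]
    positivity
  have hθanti : ∀ {j k}, j ≤ k → θ k ≤ θ j := fun {j k} hjk =>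
    ENNReal.ofReal_le_ofReal (Real.rpow_le_rpow (hδ0 k).le (hδanti hjk) hσ0.le)
  have h2σ : ENNReal.ofReal (2 ^ σ) ≠ 0 := by
    simp only [ne_eq, ENNReal.ofReal_eq_zero, not_le]
    positivity
  obtain ⟨U, hAU, hU1, hUsum⟩ := exists_cover_of_hausdorffMeasure_eq_zero hA
    (ε := θ k₀ / 2 / ENNReal.ofReal (2 ^ σ))
    (ENNReal.div_ne_zero.2 ⟨ENNReal.div_ne_zero.2 ⟨hθ0 k₀, by norm_num⟩, ENNReal.ofReal_ne_top⟩)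
  obtain ⟨e, he0, hesum⟩ := ENNReal.exists_pos_sum_of_countable
    (ENNReal.div_ne_zero.2 ⟨hθ0 k₀, by norm_num⟩ : θ k₀ / 2 ≠ 0) ℕ
  set w : ℕ → ℝ≥0∞ := fun n =>
    ENNReal.ofReal (2 ^ σ) * (⨆ _ : (U n).Nonempty, ediam (U n) ^ σ) + e n with hw
  set x : ℕ → ℝ := fun n => if h : (U n).Nonempty then h.some else 0 with hx
  have hwsum : ∑' n, w n < θ k₀ := by
    simp only [hw]
    rw [ENNReal.tsum_add, ENNReal.tsum_mul_left, ← ENNReal.add_halves (θ k₀)]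
    refine ENNReal.add_lt_add ?_ hesum
    rw [mul_comm]
    exact (ENNReal.lt_div_iff_mul_lt (Or.inl h2σ) (Or.inl ENNReal.ofReal_ne_top)).1 hUsum
  set Λ : Set ℝ → ℝ≥0∞ := fun B => ∑' n, B.indicator (fun _ => w n) (x n) with hΛ
  have hΛmono : ∀ {B B' : Set ℝ}, B ⊆ B' → Λ B ≤ Λ B' := fun {B B'} h =>
    ENNReal.tsum_le_tsum fun n => indicator_le_indicator_of_subset h (fun _ => zero_le) _
  have hΛlt : ∀ B, Λ B < θ k₀ := fun B =>
    (ENNReal.tsum_le_tsum fun n => indicator_le_self' (fun _ _ => zero_le) _).trans_lt hwsum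
  have hex : ∀ a ∈ A, ∃ k, θ k ≤ Λ (closedBall a (δ k)) := by
    intro a ha
    obtain ⟨n, hn⟩ := mem_iUnion.1 (hAU ha)
    have hxn : x n ∈ U n := by
      have hne : (U n).Nonempty := ⟨a, hn⟩
      simp only [hx, dif_pos hne]
      exact hne.some_mem
    suffices hk : ∃ k, ediam (U n) ≤ ENNReal.ofReal (δ k) ∧ θ k ≤ w n by
      obtain ⟨k, hk1, hk2⟩ := hk
      refine ⟨k, hk2.trans ?_⟩
      have hmem : x n ∈ closedBall a (δ k) := by
        rw [mem_closedBall, ← ENNReal.ofReal_le_ofReal_iff (hδ0 k).le, ← edist_dist]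
        exact (edist_le_ediam_of_mem hxn hn).trans hk1
      calc w n = (closedBall a (δ k)).indicator (fun _ => w n) (x n) := by
            rw [indicator_of_mem hmem]
        _ ≤ Λ (closedBall a (δ k)) := ENNReal.le_tsum n
    rcases eq_or_ne (ediam (U n)) 0 with h0 | h0
    · have hlim : Filter.Tendsto (fun k => δ k ^ σ) Filter.atTop (nhds 0) := by
        have h1 : Filter.Tendsto δ Filter.atTop (nhds 0) := by
          have := tendsto_pow_atTop_nhds_zero_of_lt_one (r := (1 / 2 : ℝ)) (by norm_num)
            (by norm_num)
          refine this.congr fun k => ?_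
          simp [hδ]
        have := h1.rpow_const (Or.inr hσ0.le)
        rwa [Real.zero_rpow hσ0.ne'] at this
      obtain ⟨k, hk⟩ := (hlim.eventually_lt_const (show (0 : ℝ) < e n from he0 n)).exists
      refine ⟨k, by rw [h0]; exact zero_le, le_add_left ?_⟩
      rw [← ENNReal.ofReal_coe_nnreal]
      exact ENNReal.ofReal_le_ofReal hk.le
    · have hfin : ediam (U n) ≠ ⊤ := ne_top_of_le_ne_top ENNReal.one_ne_top (hU1 n)
      obtain ⟨k, hk1, hk2⟩ := exists_nat_pow_near_of_lt_one (ENNReal.toReal_pos h0 hfin)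
        (ENNReal.toReal_le_of_le_ofReal zero_le_one (by simpa using hU1 n))
        (by norm_num : (0 : ℝ) < 1 / 2) (by norm_num : (1 / 2 : ℝ) < 1)
      rw [one_div, inv_pow] at hk1 hk2
      refine ⟨k, ?_, le_add_right ?_⟩
      · rw [← ENNReal.ofReal_toReal hfin]
        exact ENNReal.ofReal_le_ofReal hk2
      · rw [ciSup_pos ⟨a, hn⟩, ← ENNReal.ofReal_toReal hfin,
          ENNReal.ofReal_rpow_of_nonneg ENNReal.toReal_nonneg hσ0.le,
          ← ENNReal.ofReal_mul (by positivity),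
          ← Real.mul_rpow (by norm_num) ENNReal.toReal_nonneg]
        refine ENNReal.ofReal_le_ofReal (Real.rpow_le_rpow (hδ0 k).le ?_ hσ0.le)
        have h3 : ((2 : ℝ) ^ (k + 1))⁻¹ = ((2 : ℝ) ^ k)⁻¹ / 2 := by rw [pow_succ]; field_simp
        simp only [hδ]
        linarith
  refine ⟨fun k => {a | θ k ≤ Λ (closedBall a (δ k)) ∧ ∀ l < k, Λ (closedBall a (δ l)) < θ l},
    fun a ha => ?_, fun k c ρ hρ => ?_⟩
  · refine ⟨Nat.find (hex a ha), ?_, Nat.find_spec (hex a ha), fun l hl => ?_⟩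
    · by_contra! hlt
      exact absurd ((Nat.find_spec (hex a ha)).trans_lt (hΛlt _)) (not_lt.2 (hθanti hlt.le))
    · exact not_le.1 (Nat.find_min (hex a ha) hl)
  set 𝒜 : Set ℝ := {a | θ k ≤ Λ (closedBall a (δ k)) ∧ ∀ l < k, Λ (closedBall a (δ l)) < θ l}
    with h𝒜
  set M : Set ℝ := cthickening (2 * δ k) 𝒜 ∩ closedBall c ρ with hM
  have hρ0 : 0 < ρ := (hδ0 k).trans_le hρ
  have hnear : ∀ m ∈ M, ∃ a ∈ 𝒜, dist m a < 3 * δ k := fun m hm =>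
    mem_thickening_iff.1 (cthickening_subset_thickening' (by linarith [hδ0 k])
      (by linarith [hδ0 k]) _ hm.1)
  have hlow : ∀ m ∈ M, θ k ≤ Λ (closedBall m (4 * δ k)) := by
    intro m hm
    obtain ⟨a, ha, hma⟩ := hnear m hm
    refine ha.1.trans (hΛmono (closedBall_subset_closedBall' ?_))
    rw [dist_comm] at hma
    linarith
  have hup : M.Nonempty → Λ (closedBall c (5 * ρ)) ≤ ENNReal.ofReal ((32 * ρ) ^ σ) := by
    rintro ⟨m, hm⟩
    obtain ⟨a, ha, hma⟩ := hnear m hm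
    have hca : dist c a ≤ 4 * ρ := by
      have h1 := dist_triangle_left c a m
      have h2 := mem_closedBall.1 hm.2
      change δ k ≤ ρ at hρ
      linarith
    rcases le_or_gt (16 * ρ) 1 with h16 | h16
    · obtain ⟨l, hl1, hl2⟩ := exists_nat_pow_near_of_lt_one (by positivity : 0 < 16 * ρ) h16
        (by norm_num : (0 : ℝ) < 1 / 2) (by norm_num : (1 / 2 : ℝ) < 1)
      rw [one_div, inv_pow] at hl1 hl2
      have hlk : l < k := by
        by_contra! hkl
        have : δ l ≤ δ k := hδanti hkl
        simp only [hδ] at this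
        linarith
      refine (hΛmono (closedBall_subset_closedBall' ?_)).trans ((ha.2 l hlk).le.trans ?_)
      · simp only [hδ]
        linarith
      · refine ENNReal.ofReal_le_ofReal (Real.rpow_le_rpow (hδ0 l).le ?_ hσ0.le)
        have h3 : ((2 : ℝ) ^ (l + 1))⁻¹ = ((2 : ℝ) ^ l)⁻¹ / 2 := by rw [pow_succ]; field_simp
        simp only [hδ]
        linarith
    · refine (hΛlt _).le.trans (ENNReal.ofReal_le_ofReal (Real.rpow_le_rpow (hδ0 _).le ?_ hσ0.le))
      have : δ k₀ ≤ 1 := inv_le_one_of_one_le₀ (one_le_pow₀ (by norm_num))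
      linarith
  rcases M.eq_empty_or_nonempty with h0 | hne
  · rw [h0, measure_empty]
    exact zero_le
  have hMm : MeasurableSet M := isClosed_cthickening.measurableSet.inter measurableSet_closedBall
  have hintg : θ k * volume M ≤ ENNReal.ofReal (8 * δ k) * Λ (closedBall c (5 * ρ)) := by
    calc θ k * volume M = ∫⁻ _ in M, θ k := by rw [setLIntegral_const]
      _ ≤ ∫⁻ m in M, Λ (closedBall m (4 * δ k)) := setLIntegral_mono' hMm hlow
      _ = ∑' n, ∫⁻ m in M, (closedBall m (4 * δ k)).indicator (fun _ => w n) (x n) := by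
          refine lintegral_tsum fun n => Measurable.aemeasurable ?_
          have : (fun m => (closedBall m (4 * δ k)).indicator (fun _ => w n) (x n)) =
              (closedBall (x n) (4 * δ k)).indicator fun _ => w n := by
            ext m
            simp only [indicator, mem_closedBall, dist_comm]
          rw [this]
          exact measurable_const.indicator measurableSet_closedBall
      _ ≤ ∑' n, ENNReal.ofReal (8 * δ k) *
            (closedBall c (5 * ρ)).indicator (fun _ => w n) (x n) := by
          refine ENNReal.tsum_le_tsum fun n => ?_
          by_cases hxn : x n ∈ closedBall c (5 * ρ)
          · rw [indicator_of_mem hxn]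
            have h1 : ∀ m, (closedBall m (4 * δ k)).indicator (fun _ => w n) (x n) =
                (closedBall (x n) (4 * δ k)).indicator (fun _ => w n) m := fun m => by
              simp only [indicator, mem_closedBall, dist_comm]
            simp only [h1]
            refine (setLIntegral_le_lintegral _ _).trans ?_
            rw [lintegral_indicator measurableSet_closedBall, setLIntegral_const,
              Real.volume_closedBall, mul_comm]
            exact mul_le_mul' (ENNReal.ofReal_le_ofReal (by linarith)) le_rfl
          · rw [indicator_of_notMem hxn, mul_zero, nonpos_iff_eq_zero]
            rw [setLIntegral_congr_fun (g := fun _ => 0) hMm, lintegral_zero]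
            intro m hm
            refine indicator_of_notMem (fun hcon => hxn ?_) _
            rw [mem_closedBall] at hcon ⊢
            have h2 := mem_closedBall.1 hm.2
            have h3 := dist_triangle (x n) m c
            change δ k ≤ ρ at hρ
            linarith
      _ = _ := ENNReal.tsum_mul_left
  have hfin := hintg.trans (mul_le_mul_right (hup hne) _)
  rw [← ENNReal.ofReal_mul (by have := hδ0 k; positivity), mul_comm,
    ← ENNReal.le_div_iff_mul_le (Or.inl (hθ0 k)) (Or.inl ENNReal.ofReal_ne_top)] at hfin
  refine hfin.trans ?_
  have hpos : 0 < δ k ^ σ := Real.rpow_pos_of_pos (hδ0 k) σ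
  rw [← ENNReal.ofReal_div_of_pos hpos]
  refine ENNReal.ofReal_le_ofReal ?_
  have h32 : (32 : ℝ) ^ σ ≤ 32 := by
    calc (32 : ℝ) ^ σ ≤ 32 ^ (1 : ℝ) := Real.rpow_le_rpow_of_exponent_le (by norm_num) hσ1
      _ = 32 := Real.rpow_one _
  rw [div_le_iff₀ hpos, Real.mul_rpow (by norm_num) hρ0.le]
  have h4 : δ k ^ (1 - σ) * δ k ^ σ = δ k := by
    rw [← Real.rpow_add (hδ0 k), sub_add_cancel, Real.rpow_one]
  have h5 : 0 < ρ ^ σ := Real.rpow_pos_of_pos hρ0 σ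
  calc 8 * δ k * (32 ^ σ * ρ ^ σ) ≤ 8 * δ k * (32 * ρ ^ σ) := by
        have := hδ0 k
        gcongr
    _ = 256 * ((δ k ^ (1 - σ) * δ k ^ σ) * ρ ^ σ) := by rw [h4]; ring
    _ = _ := by ring

end KatzTao

section Hat

/-- The hat function of width `r` with unit integral. -/
def hat (r q : ℝ) : ℝ := max 0 (r - |q|) / r ^ 2

lemma hat_nonneg (r q : ℝ) : 0 ≤ hat r q := by
  unfold hat
  positivity

lemma hat_le {r : ℝ} (hr : 0 < r) (q : ℝ) : hat r q ≤ 1 / r := by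
  rw [hat, div_le_div_iff₀ (by positivity) hr]
  have : max 0 (r - |q|) ≤ r := max_le hr.le (by linarith [abs_nonneg q])
  nlinarith

lemma hat_eq_zero {r q : ℝ} (h : r ≤ |q|) : hat r q = 0 := by
  rw [hat, max_eq_left (by linarith), zero_div]

lemma hat_neg (r q : ℝ) : hat r (-q) = hat r q := by
  rw [hat, hat, abs_neg]

@[fun_prop]
lemma continuous_hat (r : ℝ) : Continuous (hat r) := by
  unfold hat
  fun_prop

/-- The unnormalised Haar function of scale `r` based at `p`. -/
def haar (r p u : ℝ) : ℝ :=
  (Ico p (p + r)).indicator 1 u - (Ico (p + r) (p + r + r)).indicator 1 u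

lemma integrable_indicator_Ico_mul (a b c d : ℝ) :
    Integrable fun u => (Ico a b).indicator (1 : ℝ → ℝ) u * (Ico c d).indicator (1 : ℝ → ℝ) u := by
  simp only [← inter_indicator_mul, Pi.one_apply, mul_one]
  refine (integrable_indicator_iff (measurableSet_Ico.inter measurableSet_Ico)).2
    (integrableOn_const ?_)
  exact ((measure_mono inter_subset_left).trans_lt measure_Ico_lt_top).ne

lemma integral_indicator_Ico_mul (r a b : ℝ) :
    ∫ u, (Ico a (a + r)).indicator (1 : ℝ → ℝ) u * (Ico b (b + r)).indicator (1 : ℝ → ℝ) u =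
      max 0 (r - |a - b|) := by
  simp only [← inter_indicator_mul, Pi.one_apply, mul_one]
  rw [Ico_inter_Ico, integral_indicator measurableSet_Ico, setIntegral_const, smul_eq_mul, mul_one,
    measureReal_def, Real.volume_Ico, ENNReal.toReal_ofReal', max_comm]
  congr 1
  rcases le_total a b with h | h
  · rw [min_eq_left (by linarith), max_eq_right h, abs_of_nonpos (by linarith)]
    ring
  · rw [min_eq_right (by linarith), max_eq_left h, abs_of_nonneg (by linarith)]
    ring

lemma integrable_haar_mul_haar (r p q : ℝ) : Integrable fun u => haar r p u * haar r q u := by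
  have h : (fun u => haar r p u * haar r q u) = fun u =>
      (Ico p (p + r)).indicator (1 : ℝ → ℝ) u * (Ico q (q + r)).indicator (1 : ℝ → ℝ) u
      - (Ico p (p + r)).indicator (1 : ℝ → ℝ) u * (Ico (q + r) (q + r + r)).indicator 1 u
      - (Ico (p + r) (p + r + r)).indicator (1 : ℝ → ℝ) u * (Ico q (q + r)).indicator 1 u
      + (Ico (p + r) (p + r + r)).indicator (1 : ℝ → ℝ) u *
        (Ico (q + r) (q + r + r)).indicator 1 u := by
    ext u
    unfold haar
    ring
  rw [h]
  exact (((integrable_indicator_Ico_mul _ _ _ _).sub (integrable_indicator_Ico_mul _ _ _ _)).sub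
    (integrable_indicator_Ico_mul _ _ _ _)).add (integrable_indicator_Ico_mul _ _ _ _)

lemma max_two_mul_sub_abs {r : ℝ} (hr : 0 < r) (d : ℝ) :
    max 0 (2 * r - |d|) =
      max 0 (r - |d - r|) + 2 * max 0 (r - |d|) + max 0 (r - |d + r|) := by
  simp only [max_def, abs_eq_max_neg]
  split_ifs <;> linarith

/-- The difference of hats of consecutive dyadic widths is a positive definite kernel. -/
lemma hat_sub_hat_eq_integral {r : ℝ} (hr : 0 < r) (p q : ℝ) :
    hat r (p - q) - hat (2 * r) (p - q) = (4 * r ^ 2)⁻¹ * ∫ u, haar r p u * haar r q u := by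
  have h : (fun u => haar r p u * haar r q u) = fun u =>
      (Ico p (p + r)).indicator (1 : ℝ → ℝ) u * (Ico q (q + r)).indicator (1 : ℝ → ℝ) u
      - (Ico p (p + r)).indicator (1 : ℝ → ℝ) u * (Ico (q + r) (q + r + r)).indicator 1 u
      - (Ico (p + r) (p + r + r)).indicator (1 : ℝ → ℝ) u * (Ico q (q + r)).indicator 1 u
      + (Ico (p + r) (p + r + r)).indicator (1 : ℝ → ℝ) u *
        (Ico (q + r) (q + r + r)).indicator 1 u := by
    ext u
    unfold haar
    ring
  have i1 := fun a b c d => integrable_indicator_Ico_mul a b c d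
  have key : ∀ f₁ f₂ f₃ f₄ : ℝ → ℝ, Integrable f₁ → Integrable f₂ → Integrable f₃ →
      Integrable f₄ → ∫ u, (f₁ u - f₂ u - f₃ u + f₄ u) =
        (∫ u, f₁ u) - (∫ u, f₂ u) - (∫ u, f₃ u) + ∫ u, f₄ u := by
    intro f₁ f₂ f₃ f₄ h₁ h₂ h₃ h₄
    have h₅ : Integrable fun u => f₁ u - f₂ u := h₁.sub h₂
    have h₆ : Integrable fun u => f₁ u - f₂ u - f₃ u := h₅.sub h₃
    rw [integral_add h₆ h₄, integral_sub h₅ h₃, integral_sub h₁ h₂]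
  rw [h, key _ _ _ _ (i1 _ _ _ _) (i1 _ _ _ _) (i1 _ _ _ _) (i1 _ _ _ _)]
  simp only [integral_indicator_Ico_mul]
  rw [hat, hat, max_two_mul_sub_abs hr, show p - (q + r) = p - q - r by ring,
    show p + r - q = p - q + r by ring, show p + r - (q + r) = p - q by ring]
  field_simp
  ring

/-- Arithmetic-geometric mean inequality for the positive definite kernel
`hat r - hat (2 * r)`. -/
lemma sum_hat_sub_hat_le {κ κ' : Type} (t : Finset κ) (t' : Finset κ') (w p : κ → ℝ)
    (w' p' : κ' → ℝ) {r lam : ℝ} (hr : 0 < r) (hlam : 0 < lam) :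
    ∑ i ∈ t, ∑ j ∈ t', w i * w' j * (hat r (p i - p' j) - hat (2 * r) (p i - p' j)) ≤
      lam / 2 * ∑ i ∈ t', ∑ j ∈ t',
        w' i * w' j * (hat r (p' i - p' j) - hat (2 * r) (p' i - p' j)) +
      1 / (2 * lam) * ∑ i ∈ t, ∑ j ∈ t,
        w i * w j * (hat r (p i - p j) - hat (2 * r) (p i - p j)) := by
  have key : ∀ {κ κ' : Type} (t : Finset κ) (t' : Finset κ') (w p : κ → ℝ) (w' p' : κ' → ℝ),
      Integrable (fun u => (∑ i ∈ t, w i * haar r (p i) u) * ∑ j ∈ t', w' j * haar r (p' j) u) ∧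
      ∑ i ∈ t, ∑ j ∈ t', w i * w' j * (hat r (p i - p' j) - hat (2 * r) (p i - p' j)) =
        (4 * r ^ 2)⁻¹ *
          ∫ u, (∑ i ∈ t, w i * haar r (p i) u) * ∑ j ∈ t', w' j * haar r (p' j) u := by
    intro κ κ' t t' w p w' p'
    have h1 : (fun u => (∑ i ∈ t, w i * haar r (p i) u) * ∑ j ∈ t', w' j * haar r (p' j) u) =
        fun u => ∑ i ∈ t, ∑ j ∈ t', w i * w' j * (haar r (p i) u * haar r (p' j) u) := by
      ext u
      rw [Finset.sum_mul_sum]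
      refine Finset.sum_congr rfl fun i _ => Finset.sum_congr rfl fun j _ => ?_
      ring
    have h2 : ∀ i j, Integrable fun u => w i * w' j * (haar r (p i) u * haar r (p' j) u) :=
      fun i j => (integrable_haar_mul_haar r _ _).const_mul _
    rw [h1]
    refine ⟨integrable_finsetSum _ fun i _ => integrable_finsetSum _ fun j _ => h2 i j, ?_⟩
    rw [integral_finsetSum _ fun i _ => integrable_finsetSum _ fun j _ => h2 i j,
      Finset.mul_sum]
    refine Finset.sum_congr rfl fun i _ => ?_
    rw [integral_finsetSum _ fun j _ => h2 i j, Finset.mul_sum]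
    refine Finset.sum_congr rfl fun j _ => ?_
    rw [integral_const_mul, hat_sub_hat_eq_integral hr]
    ring
  obtain ⟨i1, e1⟩ := key t t' w p w' p'
  obtain ⟨i2, e2⟩ := key t' t' w' p' w' p'
  obtain ⟨i3, e3⟩ := key t t w p w p
  rw [e1, e2, e3]
  have h3 : ∫ u, (∑ i ∈ t, w i * haar r (p i) u) * ∑ j ∈ t', w' j * haar r (p' j) u ≤
      lam / 2 * (∫ u, (∑ i ∈ t', w' i * haar r (p' i) u) * ∑ j ∈ t', w' j * haar r (p' j) u) +
      1 / (2 * lam) * ∫ u, (∑ i ∈ t, w i * haar r (p i) u) * ∑ j ∈ t, w j * haar r (p j) u := by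
    rw [← integral_const_mul, ← integral_const_mul,
      ← integral_add (i2.const_mul _) (i3.const_mul _)]
    refine integral_mono i1 ((i2.const_mul _).add (i3.const_mul _)) fun u => ?_
    set F := ∑ i ∈ t, w i * haar r (p i) u
    set G := ∑ j ∈ t', w' j * haar r (p' j) u
    have h4 : lam / 2 * (G * G) + 1 / (2 * lam) * (F * F) - F * G =
        (lam * G - F) ^ 2 / (2 * lam) := by
      field_simp
      ring
    have h5 : 0 ≤ (lam * G - F) ^ 2 / (2 * lam) := by positivity
    change F * G ≤ lam / 2 * (G * G) + 1 / (2 * lam) * (F * F)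
    linarith
  have h6 : (0 : ℝ) < (4 * r ^ 2)⁻¹ := by positivity
  nlinarith [mul_le_mul_of_nonneg_left h3 h6.le]

lemma sum_hat_sub_hat_nonneg {κ : Type} (t : Finset κ) (w p : κ → ℝ) {r : ℝ} (hr : 0 < r) :
    0 ≤ ∑ i ∈ t, ∑ j ∈ t, w i * w j * (hat r (p i - p j) - hat (2 * r) (p i - p j)) := by
  have := sum_hat_sub_hat_le (∅ : Finset κ) t w p w p hr two_pos
  simp only [Finset.sum_empty, mul_zero, add_zero] at this
  linarith

end Hat

section Charts

lemma integral_hat {r c : ℝ} (hr : 0 < r) (hc : r ≤ c) : ∫ u in (0 : ℝ)..c, hat r u = 1 / 2 := by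
  have hi : ∀ a b, IntervalIntegrable (hat r) volume a b := fun a b =>
    (continuous_hat r).intervalIntegrable a b
  rw [← intervalIntegral.integral_add_adjacent_intervals (hi 0 r) (hi r c)]
  have h1 : ∫ u in (0 : ℝ)..r, hat r u = ∫ u in (0 : ℝ)..r, (r - u) / r ^ 2 := by
    refine intervalIntegral.integral_congr fun u hu => ?_
    rw [uIcc_of_le hr.le] at hu
    simp only [hat]
    rw [abs_of_nonneg hu.1, max_eq_right (by linarith [hu.2])]
  have h2 : ∫ u in r..c, hat r u = ∫ u in r..c, (0 : ℝ) := by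
    refine intervalIntegral.integral_congr fun u hu => ?_
    rw [uIcc_of_le hc] at hu
    exact hat_eq_zero (hu.1.trans (le_abs_self u))
  rw [h1, h2, intervalIntegral.integral_zero, intervalIntegral.integral_div,
    intervalIntegral.integral_sub (by simp) (by simp)]
  simp only [intervalIntegral.integral_const, integral_id, smul_eq_mul]
  field_simp
  ring

/-- The odd primitive of `hat r - hat (2 * r)`. -/
def hatPrimitive (r q : ℝ) : ℝ := ∫ u in (0 : ℝ)..q, (hat r u - hat (2 * r) u)

lemma intervalIntegrable_hat_sub (r a b : ℝ) :
    IntervalIntegrable (fun u => hat r u - hat (2 * r) u) volume a b :=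
  ((continuous_hat r).sub (continuous_hat (2 * r))).intervalIntegrable a b

lemma hatPrimitive_neg (r q : ℝ) : hatPrimitive r (-q) = -hatPrimitive r q := by
  have h := intervalIntegral.integral_comp_neg (a := 0) (b := q)
    (fun u => hat r u - hat (2 * r) u)
  simp only [hat_neg, neg_zero] at h
  rw [hatPrimitive, hatPrimitive, h, intervalIntegral.integral_symm]

lemma hatPrimitive_eq_zero {r q : ℝ} (hr : 0 < r) (hq : 2 * r ≤ |q|) : hatPrimitive r q = 0 := by
  have key : ∀ c, 2 * r ≤ c → hatPrimitive r c = 0 := fun c hc => by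
    rw [hatPrimitive, intervalIntegral.integral_sub ((continuous_hat r).intervalIntegrable _ _)
      ((continuous_hat _).intervalIntegrable _ _), integral_hat hr (by linarith),
      integral_hat (by linarith) hc, sub_self]
  rcases le_abs.1 hq with h | h
  · exact key q h
  · rw [← neg_neg q, hatPrimitive_neg, key _ h, neg_zero]

lemma abs_mul_hatPrimitive_le {r : ℝ} (hr : 0 < r) (q : ℝ) : |q * hatPrimitive r q| ≤ 4 * r := by
  rcases le_or_gt (2 * r) |q| with h | h
  · rw [hatPrimitive_eq_zero hr h, mul_zero, abs_zero]
    positivity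
  · have h1 : ‖hatPrimitive r q‖ ≤ 1 / r * |q - 0| := by
      refine intervalIntegral.norm_integral_le_of_norm_le_const fun u _ => ?_
      rw [Real.norm_eq_abs, abs_le]
      have h2 := hat_le hr u
      have h3 := hat_le (by linarith : 0 < 2 * r) u
      have h4 : 1 / (2 * r) ≤ 1 / r := by gcongr; linarith
      constructor <;> linarith [hat_nonneg r u, hat_nonneg (2 * r) u]
    rw [sub_zero, Real.norm_eq_abs] at h1
    rw [abs_mul]
    calc |q| * |hatPrimitive r q| ≤ 2 * r * (1 / r * (2 * r)) := by
          gcongr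
          exact h1.trans (by gcongr)
      _ = 4 * r := by field_simp; norm_num

lemma integral_hat_sub_chart {a : ℝ} (ha : a ≠ 0) (r b : ℝ) :
    ∫ m in (-1 : ℝ)..1, (hat r (b - a * m) - hat (2 * r) (b - a * m)) =
      (hatPrimitive r (b + a) - hatPrimitive r (b - a)) / a := by
  have h := intervalIntegral.integral_comp_sub_mul (a := -1) (b := 1)
    (fun u => hat r u - hat (2 * r) u) ha b
  rw [h, hatPrimitive, hatPrimitive, intervalIntegral.integral_interval_sub_left
    (intervalIntegrable_hat_sub _ _ _) (intervalIntegrable_hat_sub _ _ _), smul_eq_mul,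
    inv_mul_eq_div]
  simp

lemma integral_hat_sub_chart_eq_zero {r a b : ℝ} (hr : 0 < r) (h1 : 2 * r ≤ |b + a|)
    (h2 : 2 * r ≤ |b - a|) :
    ∫ m in (-1 : ℝ)..1, (hat r (b - a * m) - hat (2 * r) (b - a * m)) = 0 := by
  rcases eq_or_ne a 0 with rfl | ha
  · rw [add_zero] at h1
    simp only [zero_mul, sub_zero]
    rw [hat_eq_zero (by linarith), hat_eq_zero h1]
    simp
  · rw [integral_hat_sub_chart ha, hatPrimitive_eq_zero hr h1, hatPrimitive_eq_zero hr h2]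
    simp

lemma integral_hat_sub_chart_le {r : ℝ} (hr : 0 < r) (a b : ℝ) :
    ∫ m in (-1 : ℝ)..1, (hat r (b - a * m) - hat (2 * r) (b - a * m)) ≤ 2 / r := by
  have h1 : ∀ u, hat r u - hat (2 * r) u ≤ 1 / r := fun u => by
    linarith [hat_le hr u, hat_nonneg (2 * r) u]
  calc _ ≤ ∫ _ in (-1 : ℝ)..1, 1 / r := by
        refine intervalIntegral.integral_mono_on (by norm_num)
          (Continuous.intervalIntegrable (by fun_prop) _ _) (by simp) fun m _ => h1 _
    _ = 2 / r := by
        rw [intervalIntegral.integral_const, smul_eq_mul]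
        ring

lemma rpow_neg_le_of_le_four_mul {s r M : ℝ} (hs0 : 0 ≤ s) (hs2 : s ≤ 2) (hr : 0 < r)
    (hrM : r ≤ M) (hM : M ≤ 4 * r) : 1 / r ≤ 16 * (r ^ (s - 1) * M ^ (-s)) := by
  have hM0 : 0 < M := hr.trans_le hrM
  have h1 : (4 * r) ^ (-s) ≤ M ^ (-s) := Real.rpow_le_rpow_of_nonpos hM0 hM (by linarith)
  rw [Real.mul_rpow (by norm_num) hr.le] at h1
  have h2 : (1 / 16 : ℝ) ≤ 4 ^ (-s) := by
    rw [Real.rpow_neg (by norm_num), one_div]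
    refine inv_anti₀ (by positivity) ?_
    calc (4 : ℝ) ^ s ≤ 4 ^ (2 : ℝ) := Real.rpow_le_rpow_of_exponent_le (by norm_num) hs2
      _ = 16 := by norm_num
  have h3 : r ^ (s - 1) * r ^ (-s) = 1 / r := by
    rw [← Real.rpow_add hr, show s - 1 + -s = -1 by ring, Real.rpow_neg_one, one_div]
  have h4 : (1 / 16 : ℝ) * r ^ (-s) ≤ 4 ^ (-s) * r ^ (-s) := by gcongr
  calc 1 / r = 16 * (r ^ (s - 1) * (1 / 16 * r ^ (-s))) := by rw [← h3]; ring
    _ ≤ 16 * (r ^ (s - 1) * M ^ (-s)) := by gcongr; exact h4.trans h1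

/-- Averaged over two charts of directions, the kernel `hat r - hat (2 * r)` is dominated by Riesz
kernels. -/
lemma integral_hat_sub_two_charts_le {s r : ℝ} (hs0 : 0 ≤ s) (hs2 : s ≤ 2) (hr : 0 < r) (a b : ℝ) :
    (∫ m in (-1 : ℝ)..1, (hat r (b - a * m) - hat (2 * r) (b - a * m))) +
      (∫ m in (-1 : ℝ)..1, (hat r (a - b * m) - hat (2 * r) (a - b * m))) ≤
      64 * (r ^ (s - 1) * (max (max |a| |b|) r) ^ (-s)) := by
  set N := max |a| |b| with hN
  have haN : |a| ≤ N := le_max_left _ _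
  have hbN : |b| ≤ N := le_max_right _ _
  rcases le_or_gt N (4 * r) with h | h
  · have h1 := integral_hat_sub_chart_le hr a b
    have h2 := integral_hat_sub_chart_le hr b a
    have h3 := rpow_neg_le_of_le_four_mul hs0 hs2 hr (le_max_right N r)
      (max_le h (by linarith))
    have h4 : 2 / r = 2 * (1 / r) := by ring
    linarith
  rw [max_eq_left (by linarith)]
  have hN0 : 0 < N := by linarith
  by_cases hz : 2 * r ≤ |b + a| ∧ 2 * r ≤ |b - a|
  · rw [integral_hat_sub_chart_eq_zero hr hz.1 hz.2, integral_hat_sub_chart_eq_zero hr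
      (by rw [add_comm]; exact hz.1) (by rw [abs_sub_comm]; exact hz.2)]
    rw [add_zero]; positivity
  have hab : |(|b| - |a|)| < 2 * r := by
    rw [not_and_or, not_le, not_le] at hz
    rcases hz with hz | hz
    · have := abs_abs_sub_abs_le_abs_sub b (-a)
      rw [abs_neg, sub_neg_eq_add] at this
      linarith
    · exact (abs_abs_sub_abs_le_abs_sub b a).trans_lt hz
  rw [abs_lt] at hab
  have ha : N / 2 ≤ |a| := by
    rcases max_choice |a| |b| with h' | h' <;> rw [← hN] at h' <;> linarith
  have hb : N / 2 ≤ |b| := by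
    rcases max_choice |a| |b| with h' | h' <;> rw [← hN] at h' <;> linarith
  have ha0 : a ≠ 0 := abs_pos.1 (by linarith)
  have hb0 : b ≠ 0 := abs_pos.1 (by linarith)
  have hprod : N ^ 2 / 4 ≤ |a * b| := by
    rw [abs_mul]
    nlinarith
  have heq : (∫ m in (-1 : ℝ)..1, (hat r (b - a * m) - hat (2 * r) (b - a * m))) +
      (∫ m in (-1 : ℝ)..1, (hat r (a - b * m) - hat (2 * r) (a - b * m))) =
      ((b + a) * hatPrimitive r (b + a) - (b - a) * hatPrimitive r (b - a)) / (a * b) := by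
    rw [integral_hat_sub_chart ha0, integral_hat_sub_chart hb0, add_comm a b,
      show a - b = -(b - a) by ring, hatPrimitive_neg]
    field_simp
    ring
  rw [heq]
  refine (le_abs_self _).trans ?_
  rw [abs_div]
  have hnum : |(b + a) * hatPrimitive r (b + a) - (b - a) * hatPrimitive r (b - a)| ≤ 8 * r := by
    refine (abs_sub _ _).trans ?_
    linarith [abs_mul_hatPrimitive_le hr (b + a), abs_mul_hatPrimitive_le hr (b - a)]
  have h5 : r / N ^ 2 ≤ r ^ (s - 1) * N ^ (-s) := by
    have h6 : r / N ^ 2 = r ^ (s - 1) * N ^ (-s) * (r / N) ^ (2 - s) := by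
      rw [Real.div_rpow hr.le hN0.le, div_eq_mul_inv (r ^ (2 - s)), ← Real.rpow_neg hN0.le,
        show r ^ (s - 1) * N ^ (-s) * (r ^ (2 - s) * N ^ (-(2 - s))) =
          (r ^ (s - 1) * r ^ (2 - s)) * (N ^ (-s) * N ^ (-(2 - s))) by ring,
        ← Real.rpow_add hr, ← Real.rpow_add hN0, show s - 1 + (2 - s) = 1 by ring,
        show -s + -(2 - s) = -2 by ring, Real.rpow_one, Real.rpow_neg hN0.le, div_eq_mul_inv]
      norm_num
    rw [h6]
    refine mul_le_of_le_one_right (by positivity) (Real.rpow_le_one (by positivity) ?_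
      (by linarith))
    rw [div_le_one hN0]
    linarith
  calc _ ≤ 8 * r / (N ^ 2 / 4) := by gcongr
    _ = 32 * (r / N ^ 2) := by field_simp; norm_num
    _ ≤ 64 * (r ^ (s - 1) * N ^ (-s)) := by
      have : 0 ≤ r / N ^ 2 := by positivity
      linarith

end Charts

section Incidence

/-- At scales at least `δ`, the set `A` has the volume growth of the `δ`-neighbourhood of a
`δ`-separated set of dimension `σ`, with constant `C`. -/
def NonConc (σ δ C : ℝ) (A : Set ℝ) : Prop :=
  ∀ c ρ : ℝ, δ ≤ ρ → volume (A ∩ closedBall c ρ) ≤ ENNReal.ofReal (C * (δ ^ (1 - σ) * ρ ^ σ))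

lemma volume_inter_strip_le {A : Set ℝ} {C σ τ δ r : ℝ} (hC : 0 ≤ C) (hτσ : τ ≤ σ)
    (hσ1 : σ ≤ 1) (hδ0 : 0 < δ) (hδ1 : δ ≤ 1) (hr : δ ≤ r)
    (hA : NonConc σ δ C A) {z : ℝ × ℝ} (hz : ‖z‖ ≤ 2) :
    volume (A ∩ Icc (-1) 1 ∩ {m | |z.2 - z.1 * m| ≤ r}) ≤
      ENNReal.ofReal (2 * C * δ ^ (1 - σ) * (r ^ τ * (max ‖z‖ r) ^ (-τ))) := by
  have hr0 : 0 < r := hδ0.trans_le hr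
  have hM : 0 < max ‖z‖ r := lt_max_of_lt_right hr0
  have hδp : 0 ≤ δ ^ (1 - σ) := Real.rpow_nonneg hδ0.le _
  have hτ1 : τ ≤ 1 := hτσ.trans hσ1
  rw [Real.rpow_neg hM.le, ← div_eq_mul_inv, ← Real.div_rpow hr0.le hM.le]
  rcases le_or_gt ‖z‖ (2 * r) with h | h
  · have hq : 1 / 2 ≤ r / max ‖z‖ r := by
      rw [div_le_div_iff₀ two_pos hM]
      rcases max_cases ‖z‖ r with h' | h' <;> linarith [h'.1]
    have hq1 : 1 ≤ 2 * (r / max ‖z‖ r) ^ τ := by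
      have h1 : r / max ‖z‖ r ≤ 1 := (div_le_one hM).2 (le_max_right _ _)
      have h2 := Real.rpow_le_rpow_of_exponent_ge (by linarith) h1 hτ1
      rw [Real.rpow_one] at h2
      linarith
    calc volume (A ∩ Icc (-1) 1 ∩ {m | |z.2 - z.1 * m| ≤ r})
        ≤ volume (A ∩ closedBall 0 1) := by
          apply measure_mono
          rw [Real.closedBall_eq_Icc]
          norm_num
          exact ⟨inter_subset_left.trans inter_subset_left,
            inter_subset_left.trans inter_subset_right⟩
      _ ≤ ENNReal.ofReal (C * (δ ^ (1 - σ) * 1 ^ σ)) := hA 0 1 hδ1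
      _ ≤ _ := by
          apply ENNReal.ofReal_le_ofReal
          rw [Real.one_rpow]
          nlinarith [mul_nonneg hC hδp]
  · rcases (A ∩ Icc (-1) 1 ∩ {m | |z.2 - z.1 * m| ≤ r}).eq_empty_or_nonempty with he | ⟨m, hm⟩
    · rw [he, measure_empty]; exact bot_le
    have hz1 : ‖z‖ / 2 ≤ |z.1| := by
      have h1 : |z.2 - z.1 * m| ≤ r := hm.2
      have h2 : |m| ≤ 1 := abs_le.2 hm.1.2
      have h3 : |z.2| ≤ r + |z.1| := by
        have := abs_sub_abs_le_abs_sub z.2 (z.1 * m)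
        rw [abs_mul] at this
        nlinarith [abs_nonneg z.1]
      rw [Prod.norm_def, Real.norm_eq_abs, Real.norm_eq_abs] at *
      rcases max_cases |z.1| |z.2| with h' | h' <;> linarith [h'.1, abs_nonneg z.1]
    have hn : 0 < ‖z‖ := by linarith
    have hz0 : 0 < |z.1| := by linarith
    have hρ : δ ≤ 2 * r / ‖z‖ := by
      rw [le_div_iff₀ hn]; nlinarith
    calc volume (A ∩ Icc (-1) 1 ∩ {m | |z.2 - z.1 * m| ≤ r})
        ≤ volume (A ∩ closedBall (z.2 / z.1) (2 * r / ‖z‖)) := by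
          apply measure_mono
          rintro u ⟨⟨hu, -⟩, hu'⟩
          refine ⟨hu, ?_⟩
          rw [mem_closedBall, Real.dist_eq, abs_sub_comm, le_div_iff₀ hn]
          have h1 : |z.2 - z.1 * u| = |z.1| * |z.2 / z.1 - u| := by
            rw [← abs_mul]; congr 1
            have : z.1 ≠ 0 := abs_pos.1 hz0
            field_simp
          have h2 : |z.2 - z.1 * u| ≤ r := hu'
          nlinarith [abs_nonneg (z.2 / z.1 - u)]
      _ ≤ ENNReal.ofReal (C * (δ ^ (1 - σ) * (2 * r / ‖z‖) ^ σ)) := hA _ _ hρ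
      _ ≤ _ := by
          apply ENNReal.ofReal_le_ofReal
          rw [max_eq_left (by linarith : r ≤ ‖z‖)]
          have h1 : (2 * r / ‖z‖) ^ σ ≤ 2 * (r / ‖z‖) ^ τ := by
            calc (2 * r / ‖z‖) ^ σ ≤ (2 * r / ‖z‖) ^ τ :=
                  Real.rpow_le_rpow_of_exponent_ge (by positivity) ((div_le_one hn).2 h.le) hτσ
              _ = 2 ^ τ * (r / ‖z‖) ^ τ := by
                  rw [mul_div_assoc, Real.mul_rpow two_pos.le (by positivity)]
              _ ≤ 2 * (r / ‖z‖) ^ τ := by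
                  gcongr
                  calc (2 : ℝ) ^ τ ≤ 2 ^ (1 : ℝ) :=
                        Real.rpow_le_rpow_of_exponent_le one_le_two hτ1
                    _ = 2 := Real.rpow_one 2
          calc C * (δ ^ (1 - σ) * (2 * r / ‖z‖) ^ σ)
              ≤ C * (δ ^ (1 - σ) * (2 * (r / ‖z‖) ^ τ)) := by gcongr
            _ = _ := by ring

lemma integrable_mul_Icc {c f : ℝ → ℝ} (hc : Measurable c) (hc1 : ∀ u, |c u| ≤ 1)
    (hf : Continuous f) : Integrable (fun u => c u * f u) (volume.restrict (Icc (-1) 1)) := by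
  refine Integrable.bdd_mul (c := 1) hf.integrableOn_Icc hc.aestronglyMeasurable ?_
  exact Filter.Eventually.of_forall hc1

lemma integral_hat_strip_le {A : Set ℝ} (hAm : MeasurableSet A) {C σ τ δ r : ℝ} (hC : 0 ≤ C)
    (hτσ : τ ≤ σ) (hσ1 : σ ≤ 1) (hδ0 : 0 < δ) (hδ1 : δ ≤ 1) (hr : δ ≤ r)
    (hA : NonConc σ δ C A) {z : ℝ × ℝ} (hz : ‖z‖ ≤ 2) :
    ∫ u in Icc (-1 : ℝ) 1, A.indicator 1 u * hat r (z.2 - z.1 * u) ≤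
      2 * C * δ ^ (1 - σ) * (r ^ (τ - 1) * (max ‖z‖ r) ^ (-τ)) := by
  have hr0 : 0 < r := hδ0.trans_le hr
  set S := {m | |z.2 - z.1 * m| ≤ r} with hS
  have hSm : MeasurableSet S := by
    apply IsClosed.measurableSet
    apply isClosed_le <;> fun_prop
  have hvol := volume_inter_strip_le hC hτσ hσ1 hδ0 hδ1 hr hA hz
  have hfin : volume (A ∩ Icc (-1) 1 ∩ S) ≠ ∞ := ne_top_of_le_ne_top ENNReal.ofReal_ne_top hvol
  calc ∫ u in Icc (-1 : ℝ) 1, A.indicator 1 u * hat r (z.2 - z.1 * u)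
      ≤ ∫ u in Icc (-1 : ℝ) 1, (A ∩ S).indicator (fun _ => 1 / r) u := by
        apply integral_mono_of_nonneg
        · refine Filter.Eventually.of_forall fun u => ?_
          exact mul_nonneg (indicator_nonneg (fun _ _ => zero_le_one) _) (hat_nonneg _ _)
        · exact (integrable_const _).indicator (hAm.inter hSm)
        · refine Filter.Eventually.of_forall fun u => ?_
          by_cases hu : u ∈ A
          · by_cases hu' : u ∈ S
            · simp only [indicator_of_mem hu, indicator_of_mem (mem_inter hu hu'), Pi.one_apply,
                one_mul]
              exact hat_le hr0 _
            · have : hat r (z.2 - z.1 * u) = 0 := hat_eq_zero (not_le.1 hu').le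
              simp only [this, mul_zero]
              exact indicator_nonneg (fun _ _ => by positivity) _
          · simp only [indicator_of_notMem hu, zero_mul]
            exact indicator_nonneg (fun _ _ => by positivity) _
    _ = 1 / r * (volume (A ∩ Icc (-1) 1 ∩ S)).toReal := by
        rw [integral_indicator_const _ (hAm.inter hSm), smul_eq_mul, mul_comm, measureReal_def,
          Measure.restrict_apply (hAm.inter hSm)]
        congr 3
        ext u; simp only [mem_inter_iff]; tauto
    _ ≤ 1 / r * (2 * C * δ ^ (1 - σ) * (r ^ τ * (max ‖z‖ r) ^ (-τ))) := by
        gcongr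
        exact ENNReal.toReal_le_of_le_ofReal (by positivity) hvol
    _ = _ := by
        rw [Real.rpow_sub_one hr0.ne']
        field_simp

lemma abs_indicator_one_le (A : Set ℝ) (u : ℝ) : |A.indicator (1 : ℝ → ℝ) u| ≤ 1 := by
  by_cases h : u ∈ A <;> simp [h]

lemma measurable_indicator_one {A : Set ℝ} (hA : MeasurableSet A) :
    Measurable (A.indicator (1 : ℝ → ℝ)) := measurable_one.indicator hA

lemma sum_integral_hat_sub_le_rieszEnergy {κ : Type} (t : Finset κ) {m : κ → ℝ}
    (hm : ∀ i ∈ t, 0 ≤ m i) (y : κ → ℝ × ℝ) {s δ r : ℝ} (hs0 : 0 ≤ s) (hs2 : s ≤ 2)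
    (hδ0 : 0 < δ) (hr : δ ≤ r) :
    ∫ u in Icc (-1 : ℝ) 1, ∑ i ∈ t, ∑ j ∈ t, m i * m j *
        (hat r ((y i).2 - (y i).1 * u - ((y j).2 - (y j).1 * u)) -
          hat (2 * r) ((y i).2 - (y i).1 * u - ((y j).2 - (y j).1 * u))) ≤
      64 * (r ^ (s - 1) * ∑ i ∈ t, ∑ j ∈ t, m i * m j * (max ‖y i - y j‖ δ) ^ (-s)) := by
  have hr0 : 0 < r := hδ0.trans_le hr
  have hc := continuous_hat
  have hintg : ∀ f : ℝ → ℝ, Continuous f → Integrable f (volume.restrict (Icc (-1 : ℝ) 1)) :=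
    fun f hf => hf.integrableOn_Icc
  have hsum : ∀ p q : κ → ℝ, ∫ u in Icc (-1 : ℝ) 1, ∑ i ∈ t, ∑ j ∈ t, m i * m j *
        (hat r (p i - q i * u - (p j - q j * u)) -
          hat (2 * r) (p i - q i * u - (p j - q j * u))) =
      ∑ i ∈ t, ∑ j ∈ t, m i * m j * ∫ u in (-1 : ℝ)..1,
        (hat r ((p i - p j) - (q i - q j) * u) - hat (2 * r) ((p i - p j) - (q i - q j) * u)) := by
    intro p q
    rw [integral_finsetSum]
    · refine Finset.sum_congr rfl fun i _ => ?_
      rw [integral_finsetSum]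
      · refine Finset.sum_congr rfl fun j _ => ?_
        rw [integral_const_mul, integral_Icc_eq_integral_Ioc,
          ← intervalIntegral.integral_of_le (by norm_num)]
        congr 2
        ext u
        congr 2 <;> ring
      · exact fun j _ => hintg _ (by fun_prop)
    · exact fun i _ => hintg _ (by fun_prop)
  have hnn : 0 ≤ ∫ u in Icc (-1 : ℝ) 1, ∑ i ∈ t, ∑ j ∈ t, m i * m j *
        (hat r ((y i).1 - (y i).2 * u - ((y j).1 - (y j).2 * u)) -
          hat (2 * r) ((y i).1 - (y i).2 * u - ((y j).1 - (y j).2 * u))) :=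
    integral_nonneg fun u => sum_hat_sub_hat_nonneg t m (fun i => (y i).1 - (y i).2 * u) hr0
  refine (le_add_of_nonneg_right hnn).trans ?_
  rw [hsum, hsum, ← Finset.sum_add_distrib, Finset.mul_sum, Finset.mul_sum]
  refine Finset.sum_le_sum fun i hi => ?_
  rw [← Finset.sum_add_distrib, Finset.mul_sum, Finset.mul_sum]
  refine Finset.sum_le_sum fun j hj => ?_
  rw [← mul_add]
  have h1 := integral_hat_sub_two_charts_le hs0 hs2 hr0 ((y i).1 - (y j).1) ((y i).2 - (y j).2)
  have h2 : (max ‖y i - y j‖ r) ^ (-s) ≤ (max ‖y i - y j‖ δ) ^ (-s) :=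
    Real.rpow_le_rpow_of_nonpos (lt_max_of_lt_right hδ0) (max_le_max le_rfl hr) (by linarith)
  have h3 : ‖y i - y j‖ = max |(y i).1 - (y j).1| |(y i).2 - (y j).2| := rfl
  calc _ ≤ m i * m j * (64 * (r ^ (s - 1) * (max ‖y i - y j‖ r) ^ (-s))) := by
        refine mul_le_mul_of_nonneg_left ?_ (mul_nonneg (hm i hi) (hm j hj))
        rw [h3]; exact h1
    _ ≤ m i * m j * (64 * (r ^ (s - 1) * (max ‖y i - y j‖ δ) ^ (-s))) := by
        refine mul_le_mul_of_nonneg_left ?_ (mul_nonneg (hm i hi) (hm j hj))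
        gcongr
    _ = _ := by ring

lemma sum_integral_indicator_hat_sub_le {κ : Type} (t : Finset κ) {n : κ → ℝ}
    (hn : ∀ i ∈ t, 0 ≤ n i) (x : κ → ℝ × ℝ) (hx : ∀ i ∈ t, ∀ j ∈ t, ‖x i - x j‖ ≤ 2)
    {A : κ → Set ℝ} (hAm : ∀ i, MeasurableSet (A i)) {C σ τ δ r : ℝ} (hC : 0 ≤ C)
    (hτ0 : 0 ≤ τ) (hτσ : τ ≤ σ) (hσ1 : σ ≤ 1) (hδ0 : 0 < δ) (hδ1 : δ ≤ 1) (hr : δ ≤ r)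
    (hA : ∀ i ∈ t, NonConc σ δ C (A i)) :
    ∫ u in Icc (-1 : ℝ) 1, ∑ i ∈ t, ∑ j ∈ t,
        (n i * (A i).indicator 1 u) * (n j * (A j).indicator 1 u) *
        (hat r ((x i).2 - (x i).1 * u - ((x j).2 - (x j).1 * u)) -
          hat (2 * r) ((x i).2 - (x i).1 * u - ((x j).2 - (x j).1 * u))) ≤
      2 * C * δ ^ (1 - σ) * (r ^ (τ - 1) *
        ∑ i ∈ t, ∑ j ∈ t, n i * n j * (max ‖x i - x j‖ δ) ^ (-τ)) := by
  have hr0 : 0 < r := hδ0.trans_le hr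
  have hc := continuous_hat
  have hintg : ∀ i (f : ℝ → ℝ), Continuous f →
      Integrable (fun u => (A i).indicator 1 u * f u) (volume.restrict (Icc (-1 : ℝ) 1)) :=
    fun i f hf => integrable_mul_Icc (measurable_indicator_one (hAm i))
      (abs_indicator_one_le (A i)) hf
  calc _ ≤ ∫ u in Icc (-1 : ℝ) 1, ∑ i ∈ t, ∑ j ∈ t, n i * n j *
          ((A i).indicator 1 u * hat r ((x i - x j).2 - (x i - x j).1 * u)) := by
        refine integral_mono_of_nonneg (Filter.Eventually.of_forall fun u =>
          sum_hat_sub_hat_nonneg t (fun i => n i * (A i).indicator 1 u)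
            (fun i => (x i).2 - (x i).1 * u) hr0) ?_ (Filter.Eventually.of_forall fun u => ?_)
        · refine integrable_finsetSum _ fun i _ => integrable_finsetSum _ fun j _ =>
            (hintg i _ ?_).const_mul _
          fun_prop
        · refine Finset.sum_le_sum fun i hi => Finset.sum_le_sum fun j hj => ?_
          have e : (x i).2 - (x i).1 * u - ((x j).2 - (x j).1 * u) =
            (x i - x j).2 - (x i - x j).1 * u := by simp only [Prod.fst_sub, Prod.snd_sub]; ring
          rw [e]
          set q := (x i - x j).2 - (x i - x j).1 * u
          have h1 := hat_nonneg r q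
          have h2 := hat_nonneg (2 * r) q
          have h3 := abs_le.1 (abs_indicator_one_le (A j) u)
          have h4 : 0 ≤ (A i).indicator (1 : ℝ → ℝ) u :=
            indicator_nonneg (fun _ _ => zero_le_one) _
          have h5 : 0 ≤ (A j).indicator (1 : ℝ → ℝ) u :=
            indicator_nonneg (fun _ _ => zero_le_one) _
          have h6 := mul_nonneg (hn i hi) (hn j hj)
          calc _ = n i * n j * ((A i).indicator 1 u *
                ((A j).indicator 1 u * (hat r q - hat (2 * r) q))) := by ring
            _ ≤ _ := by
              refine mul_le_mul_of_nonneg_left (mul_le_mul_of_nonneg_left ?_ h4) h6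
              nlinarith [mul_nonneg h5 h2]
    _ = ∑ i ∈ t, ∑ j ∈ t, n i * n j * ∫ u in Icc (-1 : ℝ) 1,
          ((A i).indicator 1 u * hat r ((x i - x j).2 - (x i - x j).1 * u)) := by
        rw [integral_finsetSum]
        · refine Finset.sum_congr rfl fun i _ => ?_
          rw [integral_finsetSum]
          · exact Finset.sum_congr rfl fun j _ => integral_const_mul _ _
          · exact fun j _ => (hintg i _ (by fun_prop)).const_mul _
        · exact fun i _ => integrable_finsetSum _ fun j _ => (hintg i _ (by fun_prop)).const_mul _
    _ ≤ _ := by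
        rw [Finset.mul_sum, Finset.mul_sum]
        refine Finset.sum_le_sum fun i hi => ?_
        rw [Finset.mul_sum, Finset.mul_sum]
        refine Finset.sum_le_sum fun j hj => ?_
        have h6 := mul_nonneg (hn i hi) (hn j hj)
        have h2 : (max ‖x i - x j‖ r) ^ (-τ) ≤ (max ‖x i - x j‖ δ) ^ (-τ) :=
          Real.rpow_le_rpow_of_nonpos (lt_max_of_lt_right hδ0) (max_le_max le_rfl hr) (by linarith)
        calc _ ≤ n i * n j *
              (2 * C * δ ^ (1 - σ) * (r ^ (τ - 1) * (max ‖x i - x j‖ r) ^ (-τ))) :=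
              mul_le_mul_of_nonneg_left (integral_hat_strip_le (hAm i) hC hτσ hσ1 hδ0 hδ1 hr
                (hA i hi) (hx i hi j hj)) h6
          _ ≤ n i * n j *
              (2 * C * δ ^ (1 - σ) * (r ^ (τ - 1) * (max ‖x i - x j‖ δ) ^ (-τ))) := by
              refine mul_le_mul_of_nonneg_left ?_ h6
              gcongr
          _ = _ := by ring

/-- Weighted number of incidences at scale `r` between points `x i`, `y j` and lines with slopes
in `A i`. -/
def incidence {κ κ' : Type} (t : Finset κ) (n : κ → ℝ) (x : κ → ℝ × ℝ) (A : κ → Set ℝ)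
    (t' : Finset κ') (m : κ' → ℝ) (y : κ' → ℝ × ℝ) (r : ℝ) : ℝ :=
  ∑ i ∈ t, ∑ j ∈ t', n i * m j * ∫ u in Icc (-1 : ℝ) 1,
    (A i).indicator 1 u * hat r ((x i).2 - (x i).1 * u - ((y j).2 - (y j).1 * u))

variable {κ κ' : Type} {t : Finset κ} {n : κ → ℝ} {x : κ → ℝ × ℝ} {A : κ → Set ℝ}
  {t' : Finset κ'} {m : κ' → ℝ} {y : κ' → ℝ × ℝ}

lemma incidence_sub_le (hn : ∀ i ∈ t, 0 ≤ n i) (hx : ∀ i ∈ t, ∀ j ∈ t, ‖x i - x j‖ ≤ 2)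
    (hm : ∀ i ∈ t', 0 ≤ m i)
    (hAm : ∀ i, MeasurableSet (A i)) {C σ τ s δ r : ℝ} (hC : 0 ≤ C)
    (hτ0 : 0 ≤ τ) (hτσ : τ ≤ σ) (hσ1 : σ ≤ 1) (hs0 : 0 ≤ s) (hs2 : s ≤ 2) (hsτ : s + τ ≤ 2)
    (hδ0 : 0 < δ) (hδ1 : δ ≤ 1) (hr : δ ≤ r) (hA : ∀ i ∈ t, NonConc σ δ C (A i)) :
    incidence t n x A t' m y r - incidence t n x A t' m y (2 * r) ≤
      δ ^ ((s + τ - 1 - σ) / 2) *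
        (32 * ∑ i ∈ t', ∑ j ∈ t', m i * m j * (max ‖y i - y j‖ δ) ^ (-s) +
          C * ∑ i ∈ t, ∑ j ∈ t, n i * n j * (max ‖x i - x j‖ δ) ^ (-τ)) := by
  have hr0 : 0 < r := hδ0.trans_le hr
  have hc := continuous_hat
  have hintg : ∀ i (f : ℝ → ℝ), Continuous f →
      Integrable (fun u => (A i).indicator 1 u * f u) (volume.restrict (Icc (-1 : ℝ) 1)) :=
    fun i f hf => integrable_mul_Icc (measurable_indicator_one (hAm i))
      (abs_indicator_one_le (A i)) hf
  set JY := ∑ i ∈ t', ∑ j ∈ t', m i * m j * (max ‖y i - y j‖ δ) ^ (-s)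
  set JX := ∑ i ∈ t, ∑ j ∈ t, n i * n j * (max ‖x i - x j‖ δ) ^ (-τ)
  have hJY : 0 ≤ JY := Finset.sum_nonneg fun i hi => Finset.sum_nonneg fun j hj =>
    mul_nonneg (mul_nonneg (hm i hi) (hm j hj))
      (Real.rpow_nonneg (le_max_of_le_right hδ0.le) _)
  have hJX : 0 ≤ JX := Finset.sum_nonneg fun i hi => Finset.sum_nonneg fun j hj =>
    mul_nonneg (mul_nonneg (hn i hi) (hn j hj))
      (Real.rpow_nonneg (le_max_of_le_right hδ0.le) _)
  set lam := δ ^ ((1 - σ) / 2) * r ^ ((τ - s) / 2) with hlam_def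
  have hlam : 0 < lam := by positivity
  have hY := sum_integral_hat_sub_le_rieszEnergy t' hm y hs0 hs2 hδ0 hr
  have hX := sum_integral_indicator_hat_sub_le t hn x hx hAm hC hτ0 hτσ hσ1 hδ0 hδ1 hr hA
  set FY : ℝ → ℝ := fun u => ∑ i ∈ t', ∑ j ∈ t', m i * m j *
        (hat r ((y i).2 - (y i).1 * u - ((y j).2 - (y j).1 * u)) -
          hat (2 * r) ((y i).2 - (y i).1 * u - ((y j).2 - (y j).1 * u))) with hFY
  set FX : ℝ → ℝ := fun u => ∑ i ∈ t, ∑ j ∈ t,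
        (n i * (A i).indicator 1 u) * (n j * (A j).indicator 1 u) *
        (hat r ((x i).2 - (x i).1 * u - ((x j).2 - (x j).1 * u)) -
          hat (2 * r) ((x i).2 - (x i).1 * u - ((x j).2 - (x j).1 * u))) with hFX
  have hFYi : Integrable FY (volume.restrict (Icc (-1 : ℝ) 1)) := by
    refine Continuous.integrableOn_Icc ?_
    fun_prop
  have hFXi : Integrable FX (volume.restrict (Icc (-1 : ℝ) 1)) := by
    refine integrable_finsetSum _ fun i _ => integrable_finsetSum _ fun j _ => ?_
    have h1 := integrable_mul_Icc (c := fun u => (A i).indicator 1 u * (A j).indicator 1 u)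
      (f := fun u => hat r ((x i).2 - (x i).1 * u - ((x j).2 - (x j).1 * u)) -
          hat (2 * r) ((x i).2 - (x i).1 * u - ((x j).2 - (x j).1 * u)))
      ((measurable_indicator_one (hAm i)).mul (measurable_indicator_one (hAm j)))
      (fun u => by
        rw [abs_mul]
        exact mul_le_one₀ (abs_indicator_one_le _ _) (abs_nonneg _) (abs_indicator_one_le _ _))
      (by fun_prop)
    refine (h1.const_mul (n i * n j)).congr (Filter.Eventually.of_forall fun u => ?_)
    ring
  have hdiff : incidence t n x A t' m y r - incidence t n x A t' m y (2 * r) =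
      ∫ u in Icc (-1 : ℝ) 1, ∑ i ∈ t, ∑ j ∈ t', (n i * (A i).indicator 1 u) * m j *
        (hat r ((x i).2 - (x i).1 * u - ((y j).2 - (y j).1 * u)) -
          hat (2 * r) ((x i).2 - (x i).1 * u - ((y j).2 - (y j).1 * u))) := by
    have hij : ∀ i j, Integrable (fun u => (n i * (A i).indicator 1 u) * m j *
        (hat r ((x i).2 - (x i).1 * u - ((y j).2 - (y j).1 * u)) -
          hat (2 * r) ((x i).2 - (x i).1 * u - ((y j).2 - (y j).1 * u))))
        (volume.restrict (Icc (-1 : ℝ) 1)) := by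
      intro i j
      refine ((hintg i (fun u => hat r ((x i).2 - (x i).1 * u - ((y j).2 - (y j).1 * u)) -
          hat (2 * r) ((x i).2 - (x i).1 * u - ((y j).2 - (y j).1 * u))) ?_).const_mul
          (n i * m j)).congr (Filter.Eventually.of_forall fun u => ?_)
      · fun_prop
      · ring
    rw [integral_finsetSum _ fun i _ => integrable_finsetSum _ fun j _ => hij i j]
    unfold incidence
    rw [← Finset.sum_sub_distrib]
    refine Finset.sum_congr rfl fun i _ => ?_
    rw [integral_finsetSum _ fun j _ => hij i j, ← Finset.sum_sub_distrib]
    refine Finset.sum_congr rfl fun j _ => ?_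
    rw [← mul_sub, ← integral_sub (hintg i _ (by fun_prop)) (hintg i _ (by fun_prop)),
      ← integral_const_mul]
    refine integral_congr_ae (Filter.Eventually.of_forall fun u => ?_)
    ring
  have hle : incidence t n x A t' m y r - incidence t n x A t' m y (2 * r) ≤
      lam / 2 * (∫ u in Icc (-1 : ℝ) 1, FY u) + 1 / (2 * lam) * (∫ u in Icc (-1 : ℝ) 1, FX u) := by
    rw [hdiff, ← integral_const_mul, ← integral_const_mul,
      ← integral_add (hFYi.const_mul _) (hFXi.const_mul _)]
    refine integral_mono ?_ ((hFYi.const_mul _).add (hFXi.const_mul _)) fun u => ?_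
    · refine integrable_finsetSum _ fun i _ => integrable_finsetSum _ fun j _ => ?_
      refine ((hintg i (fun u => hat r ((x i).2 - (x i).1 * u - ((y j).2 - (y j).1 * u)) -
          hat (2 * r) ((x i).2 - (x i).1 * u - ((y j).2 - (y j).1 * u))) ?_).const_mul
          (n i * m j)).congr (Filter.Eventually.of_forall fun u => ?_)
      · fun_prop
      · ring
    · exact sum_hat_sub_hat_le t t' (fun i => n i * (A i).indicator 1 u)
        (fun i => (x i).2 - (x i).1 * u) m (fun i => (y i).2 - (y i).1 * u) hr0 hlam
  have hexp : δ ^ ((1 - σ) / 2) * r ^ ((s + τ) / 2 - 1) ≤ δ ^ ((s + τ - 1 - σ) / 2) := by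
    calc δ ^ ((1 - σ) / 2) * r ^ ((s + τ) / 2 - 1)
        ≤ δ ^ ((1 - σ) / 2) * δ ^ ((s + τ) / 2 - 1) := by
          refine mul_le_mul_of_nonneg_left ?_ (by positivity)
          exact Real.rpow_le_rpow_of_nonpos hδ0 hr (by linarith)
      _ = _ := by rw [← Real.rpow_add hδ0]; congr 1; ring
  have e1 : lam * r ^ (s - 1) = δ ^ ((1 - σ) / 2) * r ^ ((s + τ) / 2 - 1) := by
    rw [hlam_def, mul_assoc, ← Real.rpow_add hr0]; congr 2; ring
  have e2 : 1 / lam * (δ ^ (1 - σ) * r ^ (τ - 1)) =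
      δ ^ ((1 - σ) / 2) * r ^ ((s + τ) / 2 - 1) := by
    rw [one_div, inv_mul_eq_iff_eq_mul₀ hlam.ne', hlam_def, mul_mul_mul_comm,
      ← Real.rpow_add hδ0, ← Real.rpow_add hr0]
    congr 2 <;> ring
  calc _ ≤ lam / 2 * (64 * (r ^ (s - 1) * JY)) +
        1 / (2 * lam) * (2 * C * δ ^ (1 - σ) * (r ^ (τ - 1) * JX)) := by
        refine hle.trans (add_le_add ?_ ?_)
        · exact mul_le_mul_of_nonneg_left hY (by positivity)
        · exact mul_le_mul_of_nonneg_left hX (by positivity)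
    _ = lam * r ^ (s - 1) * (32 * JY) + 1 / lam * (δ ^ (1 - σ) * r ^ (τ - 1)) * (C * JX) := by
        field_simp
        ring
    _ = δ ^ ((1 - σ) / 2) * r ^ ((s + τ) / 2 - 1) * (32 * JY + C * JX) := by
        rw [e1, e2]; ring
    _ ≤ _ := by gcongr

lemma incidence_one_le (hn : ∀ i ∈ t, 0 ≤ n i) (hn1 : ∑ i ∈ t, n i = 1)
    (hm : ∀ i ∈ t', 0 ≤ m i) (hm1 : ∑ i ∈ t', m i = 1)
    (hAm : ∀ i, MeasurableSet (A i)) {C σ δ : ℝ} (hC : 0 ≤ C) (hδ0 : 0 < δ) (hδ1 : δ ≤ 1)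
    (hA : ∀ i ∈ t, NonConc σ δ C (A i)) :
    incidence t n x A t' m y 1 ≤ C * δ ^ (1 - σ) := by
  have key : ∀ i ∈ t, ∀ j ∈ t', ∫ u in Icc (-1 : ℝ) 1,
      (A i).indicator 1 u * hat 1 ((x i).2 - (x i).1 * u - ((y j).2 - (y j).1 * u)) ≤
        C * δ ^ (1 - σ) := by
    intro i hi j hj
    have h1 := hA i hi 0 1 hδ1
    rw [Real.closedBall_eq_Icc, Real.one_rpow, mul_one, zero_sub, zero_add] at h1
    calc _ ≤ ∫ u in Icc (-1 : ℝ) 1, (A i).indicator 1 u := by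
          refine integral_mono_of_nonneg (Filter.Eventually.of_forall fun u => ?_) ?_
            (Filter.Eventually.of_forall fun u => ?_)
          · exact mul_nonneg (indicator_nonneg (fun _ _ => zero_le_one) _) (hat_nonneg _ _)
          · exact (integrable_const (1 : ℝ)).indicator (hAm i)
          · have h2 := hat_le one_pos ((x i).2 - (x i).1 * u - ((y j).2 - (y j).1 * u))
            rw [div_one] at h2
            exact mul_le_of_le_one_right (indicator_nonneg (fun _ _ => zero_le_one) _) h2
      _ = (volume (A i ∩ Icc (-1) 1)).toReal := by
          have := integral_indicator_const (μ := volume.restrict (Icc (-1 : ℝ) 1)) (1 : ℝ) (hAm i)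
          rw [smul_eq_mul, mul_one, measureReal_def, Measure.restrict_apply (hAm i)] at this
          exact this
      _ ≤ C * δ ^ (1 - σ) := ENNReal.toReal_le_of_le_ofReal (by positivity) h1
  calc incidence t n x A t' m y 1 ≤ ∑ i ∈ t, ∑ j ∈ t', n i * m j * (C * δ ^ (1 - σ)) :=
        Finset.sum_le_sum fun i hi => Finset.sum_le_sum fun j hj =>
          mul_le_mul_of_nonneg_left (key i hi j hj) (mul_nonneg (hn i hi) (hm j hj))
    _ = C * δ ^ (1 - σ) := by
        simp_rw [← Finset.sum_mul, ← Finset.mul_sum, hm1, mul_one, hn1, one_mul]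

lemma incidence_le (hn : ∀ i ∈ t, 0 ≤ n i) (hn1 : ∑ i ∈ t, n i = 1)
    (hx : ∀ i ∈ t, ∀ j ∈ t, ‖x i - x j‖ ≤ 2)
    (hm : ∀ i ∈ t', 0 ≤ m i) (hm1 : ∑ i ∈ t', m i = 1)
    (hAm : ∀ i, MeasurableSet (A i)) {C σ τ s : ℝ} {k : ℕ} (hC : 0 ≤ C)
    (hτ0 : 0 ≤ τ) (hτσ : τ ≤ σ) (hσ1 : σ ≤ 1) (hs0 : 0 ≤ s) (hs2 : s ≤ 2) (hsτ : s + τ ≤ 2)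
    (hA : ∀ i ∈ t, NonConc σ ((2 : ℝ) ^ k)⁻¹ C (A i)) :
    incidence t n x A t' m y ((2 : ℝ) ^ k)⁻¹ ≤
      C * ((2 : ℝ) ^ k)⁻¹ ^ (1 - σ) + k * (((2 : ℝ) ^ k)⁻¹ ^ ((s + τ - 1 - σ) / 2) *
        (32 * ∑ i ∈ t', ∑ j ∈ t', m i * m j * (max ‖y i - y j‖ ((2 : ℝ) ^ k)⁻¹) ^ (-s) +
          C * ∑ i ∈ t, ∑ j ∈ t, n i * n j * (max ‖x i - x j‖ ((2 : ℝ) ^ k)⁻¹) ^ (-τ))) := by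
  set δ := ((2 : ℝ) ^ k)⁻¹ with hδ
  have hδ0 : 0 < δ := by positivity
  have hδ1 : δ ≤ 1 := inv_le_one_of_one_le₀ (one_le_pow₀ one_le_two)
  set B := δ ^ ((s + τ - 1 - σ) / 2) *
        (32 * ∑ i ∈ t', ∑ j ∈ t', m i * m j * (max ‖y i - y j‖ δ) ^ (-s) +
          C * ∑ i ∈ t, ∑ j ∈ t, n i * n j * (max ‖x i - x j‖ δ) ^ (-τ)) with hB
  have ind : ∀ l : ℕ, l ≤ k →
      incidence t n x A t' m y ((2 : ℝ) ^ l)⁻¹ ≤ C * δ ^ (1 - σ) + l * B := by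
    intro l
    induction l with
    | zero =>
      intro _
      simpa using incidence_one_le (x := x) (y := y) hn hn1 hm hm1 hAm hC hδ0 hδ1 hA
    | succ l ih =>
      intro hl
      have h1 := ih (by omega)
      have hr : δ ≤ ((2 : ℝ) ^ (l + 1))⁻¹ :=
        inv_anti₀ (by positivity) (pow_le_pow_right₀ one_le_two hl)
      have h2 := incidence_sub_le (y := y) hn hx hm hAm hC hτ0 hτσ hσ1 hs0 hs2 hsτ hδ0 hδ1 hr hA
      have e : 2 * ((2 : ℝ) ^ (l + 1))⁻¹ = ((2 : ℝ) ^ l)⁻¹ := by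
        rw [pow_succ]; field_simp
      rw [e] at h2
      push_cast
      linarith
  exact ind k le_rfl

lemma one_fourth_le_integral_hat {B : Set ℝ} {δ : ℝ} (hδ0 : 0 < δ) (hδ : δ ≤ 1 / 4) {z : ℝ × ℝ}
    (hz1 : 1 / 2 ≤ |z.1|) (hz2 : |z.1| ≤ 2) (hz : |z.2 / z.1| ≤ 1 / 2)
    (hB : z.2 / z.1 ∈ thickening δ B) :
    1 / 4 ≤ ∫ u in Icc (-1 : ℝ) 1,
      (cthickening (2 * δ) B).indicator 1 u * hat δ (z.2 - z.1 * u) := by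
  set c := z.2 / z.1 with hc
  have hz0 : z.1 ≠ 0 := abs_pos.1 (by linarith)
  have hsub : Icc (c - δ / 4) (c + δ / 4) ⊆ Icc (-1) 1 := by
    have := abs_le.1 hz
    exact Icc_subset_Icc (by linarith) (by linarith)
  have hsubB : Icc (c - δ / 4) (c + δ / 4) ⊆ cthickening (2 * δ) B := by
    intro u hu
    obtain ⟨b, hb, hcb⟩ := mem_thickening_iff.1 hB
    refine mem_cthickening_of_dist_le u b _ _ hb ?_
    have h1 : dist u c ≤ δ / 4 := by
      rw [Real.dist_eq, abs_le]; constructor <;> linarith [hu.1, hu.2]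
    linarith [dist_triangle u c b]
  have hcm : MeasurableSet (cthickening (2 * δ) B) := isClosed_cthickening.measurableSet
  have hcont := continuous_hat δ
  have hintg := integrable_mul_Icc (measurable_indicator_one hcm) (abs_indicator_one_le _)
    (f := fun u => hat δ (z.2 - z.1 * u)) (by fun_prop)
  calc (1 : ℝ) / 4 = ∫ u in Icc (c - δ / 4) (c + δ / 4), 1 / (2 * δ) := by
        rw [setIntegral_const, smul_eq_mul, Real.volume_real_Icc_of_le (by linarith)]
        field_simp
        ring
    _ ≤ ∫ u in Icc (c - δ / 4) (c + δ / 4),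
          (cthickening (2 * δ) B).indicator 1 u * hat δ (z.2 - z.1 * u) := by
        refine setIntegral_mono_on continuous_const.integrableOn_Icc ?_ measurableSet_Icc fun u hu => ?_
        · exact hintg.mono_measure (Measure.restrict_mono hsub le_rfl)
        · rw [indicator_of_mem (hsubB hu), Pi.one_apply, one_mul]
          have h1 : |z.2 - z.1 * u| ≤ δ / 2 := by
            have e : z.2 - z.1 * u = z.1 * (c - u) := by rw [hc]; field_simp
            have h2 : |c - u| ≤ δ / 4 := by rw [abs_le]; constructor <;> linarith [hu.1, hu.2]
            rw [e, abs_mul]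
            nlinarith [abs_nonneg z.1, abs_nonneg (c - u)]
          unfold hat
          rw [div_le_div_iff₀ (by positivity) (by positivity)]
          have h3 : δ / 2 ≤ max 0 (δ - |z.2 - z.1 * u|) := le_max_of_le_right (by linarith)
          nlinarith
    _ ≤ _ := by
        refine setIntegral_mono_set hintg (Filter.Eventually.of_forall fun u => ?_)
          (LE.le.eventuallyLE hsub)
        exact mul_nonneg (indicator_nonneg (fun _ _ => zero_le_one) _) (hat_nonneg _ _)

end Incidence

section Slopes

/-- Slope of the line through two points of the plane. -/
def slopeOf (x y : ℝ × ℝ) : ℝ := (x - y).2 / (x - y).1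

lemma le_of_nonconcentrated_slopes {X : Set (ℝ × ℝ)} {σ τ s R θ EY L : ℝ} {k : ℕ} (hk : 2 ≤ k)
    (hτ0 : 0 ≤ τ) (hτσ : τ ≤ σ) (hσ1 : σ ≤ 1) (hs0 : 0 ≤ s) (hs2 : s ≤ 2) (hsτ : s + τ ≤ 2)
    (hXL : ∀ x ∈ X, ‖x‖ ≤ L) (hXd : ∀ x ∈ X, ∀ y ∈ X, ‖x - y‖ ≤ 1 / 4) (hR : 0 < R)
    (hX : ¬ CapLE (tent τ) X R) {B : ℝ × ℝ → Set ℝ}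
    (hB : ∀ x ∈ X, NonConc σ ((2 : ℝ) ^ k)⁻¹ 256 (cthickening (2 * ((2 : ℝ) ^ k)⁻¹) (B x)))
    {κ' : Type} {t' : Finset κ'} {m : κ' → ℝ} {y : κ' → ℝ × ℝ} (hm : ∀ j ∈ t', 0 ≤ m j)
    (hm1 : ∑ j ∈ t', m j = 1)
    (hE : ∑ i ∈ t', ∑ j ∈ t', m i * m j * (max ‖y i - y j‖ ((2 : ℝ) ^ k)⁻¹) ^ (-s) ≤ EY)
    (hxy : ∀ x ∈ X, ∀ j ∈ t', 1 / 2 ≤ |(x - y j).1| ∧ |(x - y j).1| ≤ 2 ∧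
      |slopeOf x (y j)| ≤ 1 / 2)
    (hθ : ∀ x ∈ X, θ ≤ ∑ j ∈ t',
      (thickening ((2 : ℝ) ^ k)⁻¹ (B x)).indicator 1 (slopeOf x (y j)) * m j) :
    θ / 4 ≤ 256 * ((2 : ℝ) ^ k)⁻¹ ^ (1 - σ) + k * (((2 : ℝ) ^ k)⁻¹ ^ ((s + τ - 1 - σ) / 2) *
        (32 * EY + 256 * (512 / R ^ 2))) := by
  obtain ⟨κ, t, n, x, hn, hn1, hxX, hen⟩ := exists_rieszEnergy_le hτ0 (by linarith) hXL hXd hR hX k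
  set δ := ((2 : ℝ) ^ k)⁻¹ with hδ
  have hδ0 : 0 < δ := by positivity
  have hδ4 : δ ≤ 1 / 4 := by
    rw [hδ, one_div]
    refine inv_anti₀ (by norm_num) ?_
    calc (4 : ℝ) = 2 ^ 2 := by norm_num
      _ ≤ 2 ^ k := pow_le_pow_right₀ one_le_two hk
  have h1 := incidence_le (t := t) (n := n) (x := x) (t' := t') (m := m) (y := y)
    (A := fun i => cthickening (2 * δ) (B (x i))) (C := 256) (σ := σ) (τ := τ) (s := s) (k := k)
    hn hn1 (fun i hi j hj => (hXd _ (hxX i hi) _ (hxX j hj)).trans (by norm_num)) hm hm1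
    (fun i => isClosed_cthickening.measurableSet) (by norm_num) hτ0 hτσ hσ1 hs0 hs2 hsτ
    (fun i hi => hB _ (hxX i hi))
  have h2 : θ / 4 ≤ incidence t n x (fun i => cthickening (2 * δ) (B (x i))) t' m y δ := by
    calc θ / 4 = ∑ i ∈ t, n i * (θ / 4) := by rw [← Finset.sum_mul, hn1, one_mul]
      _ ≤ ∑ i ∈ t, ∑ j ∈ t', n i * m j *
          ((thickening δ (B (x i))).indicator 1 (slopeOf (x i) (y j)) * (1 / 4)) := by
          refine Finset.sum_le_sum fun i hi => ?_
          have h3 := hθ _ (hxX i hi)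
          calc n i * (θ / 4) ≤ n i * ((∑ j ∈ t',
                (thickening δ (B (x i))).indicator 1 (slopeOf (x i) (y j)) * m j) / 4) := by
                refine mul_le_mul_of_nonneg_left ?_ (hn i hi)
                linarith
            _ = _ := by
                rw [Finset.sum_div, Finset.mul_sum]
                refine Finset.sum_congr rfl fun j _ => ?_
                ring
      _ ≤ _ := by
          refine Finset.sum_le_sum fun i hi => Finset.sum_le_sum fun j hj => ?_
          refine mul_le_mul_of_nonneg_left ?_ (mul_nonneg (hn i hi) (hm j hj))
          have e : ∀ u, (x i).2 - (x i).1 * u - ((y j).2 - (y j).1 * u) =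
            (x i - y j).2 - (x i - y j).1 * u := fun u => by
              simp only [Prod.fst_sub, Prod.snd_sub]; ring
          simp_rw [e]
          by_cases hmem : slopeOf (x i) (y j) ∈ thickening δ (B (x i))
          · rw [indicator_of_mem hmem, Pi.one_apply, one_mul]
            obtain ⟨ha, hb, hc⟩ := hxy _ (hxX i hi) j hj
            exact one_fourth_le_integral_hat hδ0 hδ4 ha hb hc hmem
          · rw [indicator_of_notMem hmem, zero_mul]
            exact integral_nonneg fun u =>
              mul_nonneg (indicator_nonneg (fun _ _ => zero_le_one) _) (hat_nonneg _ _)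
  refine h2.trans (h1.trans ?_)
  have h3 := hen k le_rfl
  gcongr

lemma exists_forall_scale_lt {σ ε : ℝ} (hσ1 : σ < 1) (hε : 0 < ε) (a b : ℝ) :
    ∃ k₀ : ℕ, ∀ k : ℕ, k₀ ≤ k → 256 * ((2 : ℝ) ^ k)⁻¹ ^ (1 - σ) +
      k * (((2 : ℝ) ^ k)⁻¹ ^ ε * (a + b * (k : ℝ) ^ 4)) < ((k : ℝ) ^ 2)⁻¹ / 4 := by
  have hpow : ∀ (c : ℝ) (k : ℕ), ((2 : ℝ) ^ k)⁻¹ ^ c = ((2 : ℝ) ^ (-c)) ^ k := by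
    intro c k
    rw [← Real.rpow_natCast, ← Real.rpow_natCast, ← Real.rpow_neg two_pos.le,
      ← Real.rpow_mul two_pos.le, ← Real.rpow_mul two_pos.le]
    ring_nf
  have hlt : ∀ c : ℝ, 0 < c → |(2 : ℝ) ^ (-c)| < 1 := by
    intro c hc
    rw [abs_of_pos (by positivity)]
    exact Real.rpow_lt_one_of_one_lt_of_neg one_lt_two (by linarith)
  have h1 := (tendsto_pow_const_mul_const_pow_of_abs_lt_one 2
    (hlt (1 - σ) (by linarith))).const_mul 256
  have h2 := (tendsto_pow_const_mul_const_pow_of_abs_lt_one 3 (hlt ε hε)).const_mul a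
  have h3 := (tendsto_pow_const_mul_const_pow_of_abs_lt_one 7 (hlt ε hε)).const_mul b
  have h4 := (h1.add h2).add h3
  simp only [mul_zero, add_zero] at h4
  have h5 := (h4.eventually (gt_mem_nhds (by norm_num : (0 : ℝ) < 1 / 4))).and
    (Filter.eventually_ge_atTop 1)
  obtain ⟨k₀, hk₀⟩ := Filter.eventually_atTop.1 h5
  refine ⟨k₀, fun k hk => ?_⟩
  obtain ⟨h6, h7⟩ := hk₀ k hk
  have hk1 : (0 : ℝ) < k := by exact_mod_cast h7
  rw [hpow, hpow, ← one_div, div_div, lt_div_iff₀ (by positivity)]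
  nlinarith [h6]

lemma exists_forall_mem_thickening {K : Set (ℝ × ℝ)} (hK : IsCompact K) {x : ℝ × ℝ}
    (hx : ∀ y ∈ K, (x - y).1 ≠ 0) {δ : ℕ → ℝ} (hδ : ∀ k, 0 < δ k) {𝒜 : ℕ → Set ℝ} {k₁ : ℕ}
    (h : ∀ a ∈ slopeOf x '' K, ∃ k ≥ k₁ + 1, a ∈ 𝒜 k) :
    ∃ M : ℕ, ∀ y ∈ K, ∃ k ∈ Finset.Ioc k₁ (k₁ + M), slopeOf x y ∈ thickening (δ k) (𝒜 k) := by
  set V : Set (ℝ × ℝ) := {y | (x - y).1 ≠ 0} with hV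
  have hVo : IsOpen V := isOpen_ne_fun (by fun_prop) continuous_const
  have hcont : ContinuousOn (slopeOf x) V := by
    unfold slopeOf
    exact ContinuousOn.div (by fun_prop) (by fun_prop) fun y hy => hy
  obtain ⟨M, hM⟩ := hK.elim_directed_cover
    (fun M : ℕ => ⋃ k ∈ Finset.Ioc k₁ (k₁ + M), V ∩ slopeOf x ⁻¹' thickening (δ k) (𝒜 k))
    (fun M => isOpen_biUnion fun k _ => hcont.isOpen_inter_preimage hVo isOpen_thickening)
    (fun y hy => by
      obtain ⟨k, hk, hmem⟩ := h _ (mem_image_of_mem _ hy)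
      refine mem_iUnion.2 ⟨k, mem_iUnion₂.2 ⟨k, ?_, hx y hy, ?_⟩⟩
      · rw [Finset.mem_Ioc]; omega
      · exact self_subset_thickening (hδ k) _ hmem)
    (Monotone.directed_le fun M N hMN => biUnion_subset_biUnion_left fun k hk => by
      simp only [Finset.coe_Ioc] at hk ⊢
      exact ⟨hk.1, hk.2.trans (by omega)⟩)
  refine ⟨M, fun y hy => ?_⟩
  obtain ⟨k, hk, -, hmem⟩ := mem_iUnion₂.1 (hM hy)
  exact ⟨k, hk, hmem⟩

theorem exists_hausdorffMeasure_slopes_ne_zero {X Y : Set (ℝ × ℝ)} {σ τ s L : ℝ} (hτ0 : 0 < τ)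
    (hτσ : τ ≤ σ) (hσ1 : σ < 1) (hs0 : 0 ≤ s) (hs2 : s ≤ 2) (hsτ : s + τ ≤ 2)
    (hsum : 1 + σ < s + τ) (hY : AnalyticSet Y) (hXdim : ENNReal.ofReal τ < dimH X)
    (hYdim : ENNReal.ofReal s < dimH Y) (hXL : ∀ x ∈ X, ‖x‖ ≤ L) (hYL : ∀ y ∈ Y, ‖y‖ ≤ L)
    (hXd : ∀ x ∈ X, ∀ y ∈ X, ‖x - y‖ ≤ 1 / 4) (hYd : ∀ x ∈ Y, ∀ y ∈ Y, ‖x - y‖ ≤ 1 / 4)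
    (hxy : ∀ x ∈ X, ∀ y ∈ Y, 1 / 2 ≤ |(x - y).1| ∧ |(x - y).1| ≤ 2 ∧ |slopeOf x y| ≤ 1 / 2) :
    ∃ x ∈ X, μH[σ] (slopeOf x '' Y) ≠ 0 := by
  classical
  by_contra! hcon
  have hXc : ∃ R > 0, ¬ CapLE (tent τ) X R := by
    by_contra! h
    exact hXdim.not_ge (dimH_le_of_forall_capLE_tent hτ0.le h)
  have hYc : ∃ R > 0, ¬ CapLE (tent s) Y R := by
    by_contra! h
    exact hYdim.not_ge (dimH_le_of_forall_capLE_tent hs0 h)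
  obtain ⟨RX, hRX, hX⟩ := hXc
  obtain ⟨RY, hRY, hYcap⟩ := hYc
  obtain ⟨K, hKY, hK, hKcap⟩ := exists_isCompact_not_capLE (tent_nonneg s) (continuous_tent s) hY
    (half_pos hRY).le (half_lt_self hRY) hYcap
  obtain ⟨k₀, hk₀⟩ := exists_forall_scale_lt hσ1 (by linarith : 0 < (s + τ - 1 - σ) / 2)
    (32 * (512 / (RY / 2) ^ 2)) (256 * (512 * 4 / RX ^ 2))
  set k₁ := k₀ + 1 with hk₁
  have hcover : ∀ x : ℝ × ℝ, ∃ 𝒜 : ℕ → Set ℝ, x ∈ X →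
      (∀ a ∈ slopeOf x '' K, ∃ k ≥ k₁ + 1, a ∈ 𝒜 k) ∧
      ∀ k : ℕ, NonConc σ ((2 : ℝ) ^ k)⁻¹ 256 (cthickening (2 * ((2 : ℝ) ^ k)⁻¹) (𝒜 k)) := by
    intro x
    by_cases hx : x ∈ X
    · have h0 : μH[σ] (slopeOf x '' K) = 0 :=
        measure_mono_null (image_mono hKY) (hcon x hx)
      obtain ⟨𝒜, h1, h2⟩ := exists_nonconcentrated_cover (hτ0.trans_le hτσ) hσ1.le h0 (k₁ + 1)
      exact ⟨𝒜, fun _ => ⟨h1, fun k c ρ hρ => h2 k c ρ hρ⟩⟩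
    · exact ⟨fun _ => ∅, fun h => absurd h hx⟩
  choose 𝒜 h𝒜 using hcover
  set XM : ℕ → Set (ℝ × ℝ) := fun M => {x | x ∈ X ∧ ∀ y ∈ K, ∃ k ∈ Finset.Ioc k₁ (k₁ + M),
    slopeOf x y ∈ thickening ((2 : ℝ) ^ k)⁻¹ (𝒜 x k)} with hXM
  have hXMmono : Monotone XM := by
    rintro M N hMN x ⟨hx, h⟩
    refine ⟨hx, fun y hy => ?_⟩
    obtain ⟨k, hk, hmem⟩ := h y hy
    rw [Finset.mem_Ioc] at hk
    exact ⟨k, Finset.mem_Ioc.2 ⟨hk.1, hk.2.trans (by omega)⟩, hmem⟩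
  have hXsub : X ⊆ ⋃ M, XM M := by
    intro x hx
    obtain ⟨M, hM⟩ := exists_forall_mem_thickening hK
      (fun y hy => abs_pos.1 ((by norm_num : (0 : ℝ) < 1 / 2).trans_le (hxy x hx y (hKY hy)).1))
      (δ := fun k => ((2 : ℝ) ^ k)⁻¹) (fun k => by positivity) (h𝒜 x hx).1
    exact mem_iUnion.2 ⟨M, hx, hM⟩
  obtain ⟨M, hM⟩ : ∃ M, ¬ CapLE (tent τ) (XM M) (RX / 2) := by
    by_contra! h
    exact hX ((CapLE.iUnion (tent_nonneg τ) hXMmono h (half_lt_self hRX)).mono hXsub le_rfl)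
  obtain ⟨κ', t', m, y, hm, hm1, hyK, hen⟩ := exists_rieszEnergy_le hs0 hs2
    (fun y hy => hYL y (hKY hy)) (fun x hx y hy => hYd x (hKY hx) y (hKY hy)) (half_pos hRY)
    hKcap (k₁ + M)
  set W : ℝ × ℝ → ℕ → ℝ := fun x k => ∑ j ∈ t',
    (thickening ((2 : ℝ) ^ k)⁻¹ (𝒜 x k)).indicator 1 (slopeOf x (y j)) * m j with hW
  have hsumsq : ∑ k ∈ Finset.Ioc k₁ (k₁ + M), ((k : ℝ) ^ 2)⁻¹ < 1 := by
    have h1 := sum_Ioc_inv_sq_le_sub (α := ℝ) (k := k₁) (n := k₁ + M) (by omega) (by omega)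
    have h2 : (k₁ : ℝ)⁻¹ ≤ 1 := inv_le_one_of_one_le₀ (by exact_mod_cast (by omega : 1 ≤ k₁))
    have h3 : (0 : ℝ) < ((k₁ + M : ℕ) : ℝ)⁻¹ := by
      rw [hk₁]; positivity
    linarith
  have hXk : XM M ⊆ ⋃ k ∈ Finset.Ioc k₁ (k₁ + M), {x | x ∈ X ∧ ((k : ℝ) ^ 2)⁻¹ ≤ W x k} := by
    rintro x ⟨hx, h⟩
    by_contra hnot
    simp only [mem_iUnion, not_exists, Set.mem_ofPred_eq, not_and, not_le] at hnot
    have h1 : 1 ≤ ∑ k ∈ Finset.Ioc k₁ (k₁ + M), W x k := by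
      simp only [hW]
      rw [Finset.sum_comm, ← hm1]
      refine Finset.sum_le_sum fun j hj => ?_
      obtain ⟨k, hk, hmem⟩ := h (y j) (hyK j hj)
      calc m j = (thickening ((2 : ℝ) ^ k)⁻¹ (𝒜 x k)).indicator 1 (slopeOf x (y j)) * m j := by
            rw [indicator_of_mem hmem, Pi.one_apply, one_mul]
        _ ≤ _ := Finset.single_le_sum (f := fun k =>
            (thickening ((2 : ℝ) ^ k)⁻¹ (𝒜 x k)).indicator 1 (slopeOf x (y j)) * m j)
            (fun k _ => mul_nonneg (indicator_nonneg (fun _ _ => zero_le_one) _) (hm j hj)) hk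
    have h2 : ∑ k ∈ Finset.Ioc k₁ (k₁ + M), W x k ≤
        ∑ k ∈ Finset.Ioc k₁ (k₁ + M), ((k : ℝ) ^ 2)⁻¹ :=
      Finset.sum_le_sum fun k hk => (hnot k hk hx).le
    linarith
  obtain ⟨k, hk, hkcap⟩ : ∃ k ∈ Finset.Ioc k₁ (k₁ + M),
      ¬ CapLE (tent τ) {x | x ∈ X ∧ ((k : ℝ) ^ 2)⁻¹ ≤ W x k} (RX / 2 * ((k : ℝ) ^ 2)⁻¹) := by
    by_contra! h
    refine hM ((CapLE.biUnion (tent_nonneg τ) _ _ _ h).mono hXk ?_)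
    rw [← Finset.mul_sum]
    nlinarith
  rw [Finset.mem_Ioc] at hk
  have hkpos : (0 : ℝ) < k := by exact_mod_cast (by omega : 0 < k)
  have hfin := le_of_nonconcentrated_slopes (X := {x | x ∈ X ∧ ((k : ℝ) ^ 2)⁻¹ ≤ W x k})
    (by omega : 2 ≤ k) hτ0.le hτσ hσ1.le hs0 hs2 hsτ (fun x hx => hXL x hx.1)
    (fun x hx y hy => hXd x hx.1 y hy.1) (by positivity) hkcap (B := fun x => 𝒜 x k)
    (fun x hx => (h𝒜 x hx.1).2 k) hm hm1 (hen k hk.2)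
    (fun x hx j hj => hxy x hx.1 _ (hKY (hyK j hj))) (fun x hx => hx.2)
  have hlt := hk₀ k (by omega)
  have e : 512 / (RX / 2 * ((k : ℝ) ^ 2)⁻¹) ^ 2 = 512 * 4 / RX ^ 2 * (k : ℝ) ^ 4 := by
    field_simp
    norm_num
  rw [e, ← mul_assoc 256] at hfin
  exact absurd hfin hlt.not_ge

end Slopes

section Reduction

/-- The linear isomorphism from the plane to `ℝ × ℝ` that sends `z` to `(1, 0)` and is a similarity
for the Euclidean metrics. -/
def similarityTo (z : E2) (hz : z 0 ^ 2 + z 1 ^ 2 ≠ 0) : E2 ≃L[ℝ] ℝ × ℝ :=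
  LinearEquiv.toContinuousLinearEquiv
    { toFun := fun p => ((z 0 * p 0 + z 1 * p 1) / (z 0 ^ 2 + z 1 ^ 2),
        (z 0 * p 1 - z 1 * p 0) / (z 0 ^ 2 + z 1 ^ 2))
      map_add' := fun p q => by
        ext <;> simp <;> ring
      map_smul' := fun c p => by
        ext <;> simp <;> ring
      invFun := fun w => !₂[z 0 * w.1 - z 1 * w.2, z 1 * w.1 + z 0 * w.2]
      left_inv := fun p => by
        ext i
        fin_cases i <;> simp <;> field_simp <;> ring
      right_inv := fun w => by
        ext <;> simp <;> field_simp <;> ring }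

lemma similarityTo_apply (z : E2) (hz : z 0 ^ 2 + z 1 ^ 2 ≠ 0) (p : E2) :
    similarityTo z hz p = ((z 0 * p 0 + z 1 * p 1) / (z 0 ^ 2 + z 1 ^ 2),
        (z 0 * p 1 - z 1 * p 0) / (z 0 ^ 2 + z 1 ^ 2)) := rfl

lemma similarityTo_self (z : E2) (hz : z 0 ^ 2 + z 1 ^ 2 ≠ 0) : similarityTo z hz z = (1, 0) := by
  rw [similarityTo_apply]
  ext
  · simp only; rw [div_eq_one_iff_eq hz]; ring
  · simp only; rw [mul_comm, sub_self, zero_div]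

lemma dimH_slopeOf_image_le (T : E2 ≃L[ℝ] ℝ × ℝ) (x : E2) {Y : Set E2}
    (hY : ∀ y ∈ Y, 0 < (T (y - x)).1) :
    dimH (slopeOf (T x) '' (T '' Y)) ≤ dimH (radProj x '' (Y \ {x})) := by
  set S : Set E2 := {e | 0 < (T e).1} with hS
  have hconv : Convex ℝ S := by
    have : S = T ⁻¹' (Prod.fst ⁻¹' Ioi 0) := rfl
    rw [this]
    exact ((convex_Ioi (0 : ℝ)).linear_preimage (LinearMap.fst ℝ ℝ ℝ)).linear_preimage
      T.toLinearEquiv.toLinearMap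
  have hdiff : ContDiffOn ℝ 1 (fun e => (T e).2 / (T e).1) S := by
    refine ContDiffOn.div ?_ ?_ fun e he => ne_of_gt he
    · exact (contDiff_snd.comp T.contDiff).contDiffOn
    · exact (contDiff_fst.comp T.contDiff).contDiffOn
  have hpos : ∀ y ∈ Y, 0 < ‖y - x‖ := by
    intro y hy
    rw [norm_pos_iff]
    intro h
    have := hY y hy
    rw [h, map_zero] at this
    exact lt_irrefl _ this
  have hsub : radProj x '' Y ⊆ S := by
    rintro _ ⟨y, hy, rfl⟩
    show 0 < (T (radProj x y)).1
    rw [radProj, map_smul, Prod.smul_fst, smul_eq_mul]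
    exact mul_pos (inv_pos.2 (hpos y hy)) (hY y hy)
  have himg : slopeOf (T x) '' (T '' Y) = (fun e => (T e).2 / (T e).1) '' (radProj x '' Y) := by
    rw [image_image, image_image]
    refine image_congr fun y hy => ?_
    have h1 := (inv_pos.2 (hpos y hy)).ne'
    have h2 : T x - T y = -T (y - x) := by rw [← map_sub, ← map_neg, neg_sub]
    rw [slopeOf, h2, radProj, map_smul, Prod.smul_fst, Prod.smul_snd, smul_eq_mul, smul_eq_mul,
      mul_div_mul_left _ _ h1, Prod.fst_neg, Prod.snd_neg, neg_div_neg_eq]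
  have hYx : Y \ {x} = Y := by
    refine sdiff_singleton_eq_self fun h => ?_
    have := hpos x h
    rw [sub_self, norm_zero] at this
    exact lt_irrefl _ this
  rw [himg, hYx]
  exact hdiff.dimH_image_le hconv hsub

lemma exists_le_dimH_radProj {X Y : Set E2} (hYm : MeasurableSet Y) {σ τ s : ℝ} (hτ0 : 0 < τ)
    (hτσ : τ ≤ σ) (hσ1 : σ < 1) (hs0 : 0 ≤ s) (hs2 : s ≤ 2) (hsτ : s + τ ≤ 2)
    (hsum : 1 + σ < s + τ) (hX : ENNReal.ofReal τ < dimH X) (hY : ENNReal.ofReal s < dimH Y) :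
    ∃ x ∈ X, ENNReal.ofReal σ ≤ dimH (radProj x '' (Y \ {x})) := by
  obtain ⟨x₀, hx₀, hx₀'⟩ := exists_mem_nhdsWithin_lt_dimH_of_lt_dimH hX
  have hYx₀ : ENNReal.ofReal s < dimH (Y \ {x₀}) := by
    have h1 : dimH Y ≤ dimH (Y \ {x₀} ∪ {x₀}) := dimH_mono (by simp)
    rw [dimH_union, dimH_singleton, max_eq_left (zero_le : (0 : ℝ≥0∞) ≤ _)] at h1
    exact hY.trans_le h1
  obtain ⟨y₀, hy₀, hy₀'⟩ := exists_mem_nhdsWithin_lt_dimH_of_lt_dimH hYx₀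
  have hz : (y₀ - x₀) 0 ^ 2 + (y₀ - x₀) 1 ^ 2 ≠ 0 := by
    intro h
    refine hy₀.2 (sub_eq_zero.1 ?_)
    ext i
    fin_cases i
    · simp only [Fin.zero_eta, PiLp.zero_apply]
      nlinarith [sq_nonneg ((y₀ - x₀) 0), sq_nonneg ((y₀ - x₀) 1)]
    · simp only [Fin.mk_one, PiLp.zero_apply]
      nlinarith [sq_nonneg ((y₀ - x₀) 0), sq_nonneg ((y₀ - x₀) 1)]
  set T := similarityTo (y₀ - x₀) hz with hT
  have hT1 : T y₀ - T x₀ = (1, 0) := by rw [← map_sub]; exact similarityTo_self _ hz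
  set U : E2 → Set E2 := fun p => T ⁻¹' closedBall (T p) (1 / 8) with hU
  have hUn : ∀ p, U p ∈ nhds p := fun p =>
    T.continuous.continuousAt.preimage_mem_nhds (closedBall_mem_nhds _ (by norm_num))
  have hUd : ∀ p, ∀ q ∈ T '' U p, ‖q - T p‖ ≤ 1 / 8 := by
    rintro p _ ⟨q, hq, rfl⟩
    exact mem_closedBall_iff_norm.1 hq
  have hX' : ENNReal.ofReal τ < dimH (T '' (X ∩ U x₀)) := by
    rw [T.dimH_image]
    exact hx₀' _ (inter_mem_nhdsWithin _ (hUn x₀))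
  have hY' : ENNReal.ofReal s < dimH (T '' (Y ∩ U y₀)) := by
    rw [T.dimH_image]
    exact (hy₀' _ (inter_mem_nhdsWithin _ (hUn y₀))).trans_le
      (dimH_mono (inter_subset_inter_left _ sdiff_subset))
  have hYan : AnalyticSet (T '' (Y ∩ U y₀)) :=
    (hYm.inter (isClosed_closedBall.preimage T.continuous).measurableSet).analyticSet
      |>.image_of_continuous T.continuous
  have hXU : ∀ p ∈ T '' (X ∩ U x₀), ‖p - T x₀‖ ≤ 1 / 8 := fun p hp =>
    hUd x₀ p (image_mono inter_subset_right hp)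
  have hYU : ∀ p ∈ T '' (Y ∩ U y₀), ‖p - T y₀‖ ≤ 1 / 8 := fun p hp =>
    hUd y₀ p (image_mono inter_subset_right hp)
  have hdiam : ∀ a p q : ℝ × ℝ, ‖p - a‖ ≤ 1 / 8 → ‖q - a‖ ≤ 1 / 8 → ‖p - q‖ ≤ 1 / 4 := by
    intro a p q h1 h2
    have := norm_sub_le (p - a) (q - a)
    rw [sub_sub_sub_cancel_right] at this
    linarith
  have hnorm : ∀ a p : ℝ × ℝ, ‖p - a‖ ≤ 1 / 8 → ‖p‖ ≤ ‖a‖ + 1 / 8 := by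
    intro a p h1
    have := norm_sub_norm_le p a
    linarith
  have hsep : ∀ p ∈ T '' (X ∩ U x₀), ∀ q ∈ T '' (Y ∩ U y₀),
      |(q - p).1 - 1| ≤ 1 / 4 ∧ |(q - p).2| ≤ 1 / 4 := by
    intro p hp q hq
    have h1 : ‖(q - p) - (1, 0)‖ ≤ 1 / 4 := by
      rw [← hT1]
      have := norm_sub_le (q - T y₀) (p - T x₀)
      rw [show q - p - (T y₀ - T x₀) = (q - T y₀) - (p - T x₀) by abel]
      linarith [hXU p hp, hYU q hq]
    have h2 := (norm_fst_le ((q - p) - ((1 : ℝ), (0 : ℝ)))).trans h1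
    have h3 := (norm_snd_le ((q - p) - ((1 : ℝ), (0 : ℝ)))).trans h1
    rw [Prod.fst_sub, Real.norm_eq_abs] at h2
    rw [Prod.snd_sub, Real.norm_eq_abs, sub_zero] at h3
    exact ⟨h2, h3⟩
  obtain ⟨_, ⟨x, hx, rfl⟩, hne⟩ := exists_hausdorffMeasure_slopes_ne_zero
    (L := ‖T x₀‖ + ‖T y₀‖ + 1 / 8) hτ0 hτσ hσ1 hs0 hs2 hsτ hsum hYan hX' hY'
    (fun p hp => (hnorm _ _ (hXU p hp)).trans (by linarith [norm_nonneg (T y₀)]))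
    (fun p hp => (hnorm _ _ (hYU p hp)).trans (by linarith [norm_nonneg (T x₀)]))
    (fun p hp q hq => hdiam _ _ _ (hXU p hp) (hXU q hq))
    (fun p hp q hq => hdiam _ _ _ (hYU p hp) (hYU q hq))
    (fun p hp q hq => by
      obtain ⟨h1, h2⟩ := hsep p hp q hq
      have h3 := abs_le.1 h1
      have e1 : |(p - q).1| = (q - p).1 := by
        rw [← neg_sub q p, Prod.fst_neg, abs_neg, abs_of_nonneg (by linarith)]
      have e2 : |(p - q).2| = |(q - p).2| := by
        rw [← neg_sub q p, Prod.snd_neg, abs_neg]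
      rw [slopeOf, abs_div, e1, e2]
      refine ⟨by linarith, by linarith, ?_⟩
      rw [div_le_iff₀ (by linarith)]
      linarith)
  refine ⟨x, hx.1, le_of_not_gt fun hlt => hne ?_⟩
  have h1 := dimH_slopeOf_image_le T x (Y := Y ∩ U y₀) fun y hy => by
    have := (hsep _ (mem_image_of_mem T hx) _ (mem_image_of_mem T hy)).1
    rw [← map_sub] at this
    linarith [(abs_le.1 this).1]
  have h2 : dimH (radProj x '' ((Y ∩ U y₀) \ {x})) ≤ dimH (radProj x '' (Y \ {x})) :=
    dimH_mono (image_mono (sdiff_subset_sdiff_left inter_subset_left))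
  have h3 := (h1.trans h2).trans_lt hlt
  have h4 := hausdorffMeasure_of_dimH_lt (d := σ.toNNReal) h3
  rwa [Real.coe_toNNReal _ (by linarith)] at h4

lemma dimH_exceptional_le_of_lt_one {Y : Set E2} (hYm : MeasurableSet Y) (hY : 1 < dimH Y)
    {σ : ℝ≥0∞} (hσ : σ < 1) :
    dimH {x : E2 | dimH (radProj x '' (Y \ {x})) < σ} ≤ 1 + σ - dimH Y := by
  set X := {x : E2 | dimH (radProj x '' (Y \ {x})) < σ} with hXdef
  rcases eq_or_ne σ 0 with rfl | hσ0
  · have : X = ∅ := by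
      ext x
      simp [hXdef]
    rw [this, dimH_empty]
    exact bot_le
  have hfin : ∀ S : Set E2, dimH S ≠ ∞ := by
    intro S
    refine ne_top_of_le_ne_top ?_ (dimH_mono (subset_univ S))
    rw [Real.dimH_univ_eq_finrank]
    exact ENNReal.natCast_ne_top _
  have hfin2 : dimH Y ≤ 2 := by
    refine (dimH_mono (subset_univ Y)).trans ?_
    rw [Real.dimH_univ_eq_finrank]
    simp
  by_contra! hcon
  lift σ to ℝ≥0 using (hσ.trans ENNReal.one_lt_top).ne
  obtain ⟨d, hd⟩ := WithTop.ne_top_iff_exists.1 (hfin Y)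
  obtain ⟨e, he⟩ := WithTop.ne_top_iff_exists.1 (hfin X)
  change (d : ℝ≥0∞) = dimH Y at hd
  change (e : ℝ≥0∞) = dimH X at he
  rw [← hd, ← he] at hcon
  rw [← hd] at hY hfin2
  norm_cast at hcon hY hfin2 hσ hσ0
  have he0 : (0 : ℝ) < e := by exact_mod_cast pos_of_gt hcon
  have hsum : (1 : ℝ) + σ < e + d := by 
    have := add_lt_add_left hcon d
    exact_mod_cast le_tsub_add.trans_lt this
  have hσ1 : (σ : ℝ) < 1 := by exact_mod_cast hσ
  have hσp : (0 : ℝ) < σ := by exact_mod_cast pos_iff_ne_zero.2 hσ0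
  have hd1 : (1 : ℝ) < d := by exact_mod_cast hY
  have hd2 : (d : ℝ) ≤ 2 := by exact_mod_cast hfin2
  obtain ⟨s, hs, hsd⟩ := exists_between (max_lt hd1 (by linarith : 1 + (σ : ℝ) - e < d))
  obtain ⟨hs1, hse⟩ := max_lt_iff.1 hs
  obtain ⟨τ, hτ, hτ'⟩ : ∃ τ, max 0 (1 + (σ : ℝ) - s) < τ ∧ τ < min (σ : ℝ) (min (e : ℝ) (2 - s)) :=
    exists_between (max_lt (lt_min hσp (lt_min he0 (by linarith)))
      (lt_min (by linarith) (lt_min (by linarith) (by linarith))))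
  obtain ⟨hτ0, hτs⟩ := max_lt_iff.1 hτ
  obtain ⟨hτσ, hτ''⟩ := lt_min_iff.1 hτ'
  obtain ⟨hτe, hτ2⟩ := lt_min_iff.1 hτ''
  obtain ⟨x, hx, hle⟩ := exists_le_dimH_radProj hYm (X := X) hτ0 hτσ.le hσ1 (by linarith)
    (by linarith : s ≤ 2) (by linarith) (by linarith)
    (by rw [← he, ← ENNReal.ofReal_coe_nnreal]; exact (ENNReal.ofReal_lt_ofReal_iff he0).2 hτe)
    (by
      rw [← hd, ← ENNReal.ofReal_coe_nnreal]
      exact (ENNReal.ofReal_lt_ofReal_iff (by linarith)).2 hsd)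
  rw [ENNReal.ofReal_coe_nnreal] at hle
  exact absurd hx (not_lt.2 hle)

lemma dimH_exceptional_le {Y : Set E2} (hYm : MeasurableSet Y) (hY : 1 < dimH Y)
    {σ : ℝ≥0∞} (hσ : σ ≤ 1) :
    dimH {x : E2 | dimH (radProj x '' (Y \ {x})) < σ} ≤ 1 + σ - dimH Y := by
  rcases eq_or_ne σ 0 with rfl | hσ0
  · exact dimH_exceptional_le_of_lt_one hYm hY zero_lt_one
  obtain ⟨u, -, hu, hlim⟩ := exists_seq_strictMono_tendsto' (pos_iff_ne_zero.2 hσ0)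
  have hsub : {x : E2 | dimH (radProj x '' (Y \ {x})) < σ} ⊆
      ⋃ n, {x : E2 | dimH (radProj x '' (Y \ {x})) < u n} := by
    intro x hx
    obtain ⟨n, hn⟩ := (hlim.eventually (lt_mem_nhds hx)).exists
    exact mem_iUnion.2 ⟨n, hn⟩
  refine (dimH_mono hsub).trans ?_
  rw [dimH_iUnion]
  refine iSup_le fun n => ?_
  refine (dimH_exceptional_le_of_lt_one hYm hY ((hu n).2.trans_le hσ)).trans ?_
  exact tsub_le_tsub_right (by gcongr; exact (hu n).2.le) _

end Reduction

/-- If `Y ⊆ ℝ²` is Borel with `dim_H Y > 1`, then for every `σ ∈ [0,1]`,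
`dim_H {x : dim_H π_x(Y \ {x}) < σ} ≤ max{1 + σ − dim_H Y, 0}`. -/
theorem exceptional_set_estimate (Y : Set E2) (hYm : MeasurableSet Y)
    (hY : 1 < dimH Y) (σ : ℝ≥0∞) (hσ : σ ≤ 1) :
    dimH {x : E2 | dimH (radProj x '' (Y \ {x})) < σ} ≤ max (1 + σ - dimH Y) 0 :=
  (dimH_exceptional_le hYm hY hσ).trans (le_max_left _ _)
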